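/- Let n ≥ 6 and let β be a partition of n which either has all parts ≥ 3, or equals [1, n−1]. Let ξ_{n,m} denote the number of pairs (σ, ω) of permutations of {1,…,n} such that σ has cycle type [2, n−2], ω has cycle type β, and the product σω has exactly m cycles. Then both sequences (ξ_{n,1}, ξ_{n,3}, ξ_{n,5}, …) and (ξ_{n,2}, ξ_{n,4}, ξ_{n,6}, …) are log-concave (each term squared is at least the product of its two neighbors) and unimodal. -/

import Mathlib

open Polynomial
open scoped Classical

/-- The cycle type of a permutation of `Fin n` as a partition of `n`,
including fixed points as parts equal to `1`. -/
noncomputable def fullCycleType {n : ℕ} (σ : Equiv.Perm (Fin n)) : Multiset ℕ :=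
  σ.cycleType + Multiset.replicate (n - σ.cycleType.sum) 1

/-- The number of disjoint cycles of a permutation, fixed points included. -/
noncomputable def numCycles {n : ℕ} (σ : Equiv.Perm (Fin n)) : ℕ :=
  Multiset.card (fullCycleType σ)

/-- The set (conjugacy class) of permutations of `Fin n` with full cycle type `β`. -/
noncomputable def permClass (n : ℕ) (β : Multiset ℕ) : Finset (Equiv.Perm (Fin n)) :=
  Finset.univ.filter (fun ω => fullCycleType ω = β)

/-- The polynomial `P_{[2,n-2],β}(x) = (n(n-1)/|C_β|) ⬝ Σ_{ρ(ω)=β} x^{κ(αω)}`. -/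
noncomputable def Pperm {n : ℕ} (α : Equiv.Perm (Fin n)) (β : Multiset ℕ) : Polynomial ℚ :=
  Polynomial.C (((n : ℚ) * ((n : ℚ) - 1)) / ((permClass n β).card : ℚ)) *
    ∑ ω ∈ permClass n β, Polynomial.X ^ (numCycles (α * ω))

/-- The polynomial `binom(x + c, k)` in `x`: for `k ≥ 0` it is
`(x+c)(x+c-1)⋯(x+c-k+1)/k!`, and it is `0` for `k < 0`. -/
noncomputable def binomPoly (c k : ℤ) : Polynomial ℚ :=
  if 0 ≤ k then
    (((k.toNat).factorial : ℚ))⁻¹ •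
      ((descPochhammer ℚ k.toNat).comp (Polynomial.X + Polynomial.C (c : ℚ)))
  else 0

/-- The signless Stirling number of the first kind: the number of permutations of
an `N`-element set with exactly `m` cycles (fixed points included). -/
noncomputable def stirling1 (N m : ℕ) : ℕ :=
  (Finset.univ.filter (fun σ : Equiv.Perm (Fin N) => numCycles σ = m)).card

/-- For a Young diagram with row lengths `L` (rows and columns 0-indexed),
the product `∏_{u} (t + c(u))` over the cells `u`, `c(u)` being the content. -/
def contentProd (L : List ℕ) (t : ℤ) : ℤ :=
  ∏ i ∈ Finset.range L.length, ∏ j ∈ Finset.range (L.getD i 0), (t + (j : ℤ) - (i : ℤ))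

/-- `C(a, b)` for an integer `b`: the usual binomial coefficient when `b ≥ 0`
(which is `0` for `b > a`), and `0` when `b < 0`. -/
def chooseZ (a : ℕ) (b : ℤ) : ℚ := if 0 ≤ b then (a.choose b.toNat : ℚ) else 0

open Equiv Equiv.Perm in
theorem numCycles_eq {n : ℕ} (σ : Perm (Fin n)) :
    numCycles σ = Multiset.card σ.cycleType + (n - σ.support.card) := by
  simp [numCycles, fullCycleType, sum_cycleType]

open Equiv Equiv.Perm in
theorem numCycles_swap_mul {n : ℕ} (σ : Perm (Fin n)) (a : Fin n) (ha : σ a ≠ a) :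
    numCycles (swap a (σ a) * σ) = numCycles σ + 1 := by
  set c := σ.cycleOf a with hc
  have hcyc : c.IsCycle := isCycle_cycleOf σ ha
  have hmem : c ∈ σ.cycleFactorsFinset := cycleOf_mem_cycleFactorsFinset_iff.2 (mem_support.2 ha)
  have hdis : Disjoint (σ * c⁻¹) c := disjoint_mul_inv_of_mem_cycleFactorsFinset hmem
  set τ := σ * c⁻¹ with hτ
  have hcomm : τ * c = c * τ := hdis.commute
  have hσ : σ = c * τ := by rw [← hcomm, hτ]; group
  have hca : c a = σ a := cycleOf_apply_self σ a
  have hsupp : τ.support.card + c.support.card ≤ n := by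
    rw [← hdis.card_support_mul]
    simpa using Finset.card_le_univ (τ * c).support
  have hκ : numCycles σ =
      Multiset.card τ.cycleType + 1 + (n - (τ.support.card + c.support.card)) := by
    rw [numCycles_eq, hσ, ← hcomm, hdis.cycleType_mul, hdis.card_support_mul, hcyc.cycleType]
    simp
  have hca' : c a ≠ a := by rwa [hca]
  by_cases h2 : c (c a) = a
  · have hsw : c = swap a (c a) := hcyc.eq_swap_of_apply_apply_eq_self hca' h2
    have : swap a (σ a) * σ = τ := by
      conv_lhs => rw [hσ, ← hσ, ← hca, ← hsw, hσ]
      rw [hsw]; simp [← mul_assoc]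
    rw [this, hκ, numCycles_eq]
    have hc2 : c.support.card = 2 := by rw [hsw]; exact card_support_swap (Ne.symm hca')
    omega
  · have hcyc' : (swap a (c a) * c).IsCycle := hcyc.swap_mul hca' h2
    have hs' : (swap a (c a) * c).support = c.support \ {a} := support_swap_mul_eq c a h2
    have hdis' : Disjoint τ (swap a (c a) * c) := by
      rw [disjoint_iff_disjoint_support] at hdis ⊢
      rw [hs']
      exact hdis.mono_right Finset.sdiff_subset
    have hrw : swap a (σ a) * σ = τ * (swap a (c a) * c) := by
      rw [hdis'.commute.eq, mul_assoc, ← hσ, hca]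
    have hmemc : a ∈ c.support := mem_support.2 hca'
    have hcard : (c.support \ {a}).card + 1 = c.support.card := by
      rw [Finset.sdiff_singleton_eq_erase, Finset.card_erase_add_one hmemc]
    rw [hrw, hκ, numCycles_eq, hdis'.cycleType_mul, hdis'.card_support_mul, hcyc'.cycleType, hs']
    simp only [Multiset.card_add, Multiset.card_singleton]
    omega

open Equiv Equiv.Perm in
theorem card_lt_numCycles {n : ℕ} (σ : Perm (Fin n)) (F : Finset (Fin n))
    (hF : ∀ x ∈ F, σ x = x) (hne : F ≠ Finset.univ) : F.card < numCycles σ := by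
  have h1 : F.card < n := by
    simpa using Finset.card_lt_card (Finset.ssubset_univ_iff.2 hne)
  have h2 : F.card + σ.support.card ≤ n := by
    have hd : _root_.Disjoint F σ.support := by
      rw [Finset.disjoint_left]
      intro x hx
      simp [hF x hx]
    rw [← Finset.card_union_of_disjoint hd]
    simpa using Finset.card_le_univ (F ∪ σ.support)
  rw [numCycles_eq]
  by_cases h : σ = 1
  · subst h; simpa using h1
  · have := card_cycleType_pos.2 h
    omega

theorem derivation_prod {A ι : Type*} [CommRing A] [DecidableEq ι] {K : Type*}
    [CommSemiring K] [Algebra K A] (D : Derivation K A A) (s : Finset ι)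
    (f : ι → A) : D (∏ i ∈ s, f i) = ∑ j ∈ s, D (f j) * ∏ i ∈ s.erase j, f i := by
  induction s using Finset.induction_on with
  | empty => simp
  | insert a s ha ih =>
    rw [Finset.prod_insert ha, D.leibniz, ih, Finset.sum_insert ha, Finset.erase_insert ha,
      smul_eq_mul, smul_eq_mul, Finset.mul_sum, add_comm, mul_comm _ (D (f a))]
    congr 1
    refine Finset.sum_congr rfl fun j hj => ?_
    have : j ≠ a := fun h => ha (h ▸ hj)
    rw [Finset.erase_insert_of_ne this.symm,
      Finset.prod_insert (fun h => ha (Finset.mem_of_mem_erase h))]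
    ring

/-- Jacobi's formula for the derivative of a determinant. -/
theorem derivation_det {A ι : Type*} [CommRing A] [Fintype ι] [DecidableEq ι]
    {K : Type*} [CommSemiring K] [Algebra K A] (D : Derivation K A A) (M : Matrix ι ι A) :
    D M.det = (M.adjugate * M.map D).trace := by
  have h : ∀ j, (M.adjugate * M.map D) j j = (M.updateCol j (fun i => D (M i j))).det := by
    intro j
    rw [← Matrix.cramer_apply, Matrix.cramer_eq_adjugate_mulVec]
    simp [Matrix.mul_apply, Matrix.mulVec, dotProduct]
  simp only [Matrix.trace, Matrix.diag_apply, h]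
  simp only [Matrix.det_apply]
  rw [Finset.sum_comm, map_sum]
  refine Finset.sum_congr rfl fun σ _ => ?_
  rw [← Finset.smul_sum, Units.smul_def, Units.smul_def, map_zsmul, derivation_prod]
  congr 1
  refine Finset.sum_congr rfl fun j _ => ?_
  rw [← Finset.mul_prod_erase _ _ (Finset.mem_univ j)]
  simp only [Matrix.updateCol_self]
  congr 1
  refine Finset.prod_congr rfl fun i hi => ?_
  rw [Matrix.updateCol_ne (Finset.ne_of_mem_erase hi)]

theorem det_updateCol_updateCol {A ι : Type*} [CommRing A] [Fintype ι] [DecidableEq ι]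
    (M R : Matrix ι ι A) (hMR : M * R = 1) (u v : ι → A) {a b : ι} (hab : a ≠ b) :
    ((M.updateCol a u).updateCol b v).det = M.det *
      ((R.mulVec u) a * (R.mulVec v) b - (R.mulVec v) a * (R.mulVec u) b) := by
  set p := R.mulVec u with hp
  set q := R.mulVec v with hq
  have hu : u = M.mulVec p := by rw [hp, Matrix.mulVec_mulVec, hMR, Matrix.one_mulVec]
  have hv : v = M.mulVec q := by rw [hq, Matrix.mulVec_mulVec, hMR, Matrix.one_mulVec]
  let U : Matrix ι (Fin 2) A := Matrix.of fun i k =>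
    if k = 0 then p i - (if i = a then 1 else 0) else q i - (if i = b then 1 else 0)
  let V : Matrix (Fin 2) ι A := Matrix.of fun k j =>
    if k = 0 then (if j = a then 1 else 0) else (if j = b then 1 else 0)
  have hfac : (M.updateCol a u).updateCol b v = M * (1 + U * V) := by
    ext i j
    rw [Matrix.mul_add, Matrix.mul_one, Matrix.add_apply, ← Matrix.mul_assoc]
    have h1 : (M * U * V) i j = (M.mulVec p i - M i a) * (if j = a then 1 else 0) +
        (M.mulVec q i - M i b) * (if j = b then 1 else 0) := by
      rw [Matrix.mul_apply, Fin.sum_univ_two]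
      simp [U, V, Matrix.mul_apply, Matrix.mulVec, dotProduct, mul_sub, Finset.sum_sub_distrib]
    rw [h1]
    by_cases hj : j = b
    · subst hj
      simp [hv, hab.symm]
    · by_cases hj' : j = a
      · subst hj'
        simp [hu, hab]
      · rw [Matrix.updateCol_ne hj, Matrix.updateCol_ne hj']
        simp [hj, hj']
  rw [hfac, Matrix.det_mul, Matrix.det_one_add_mul_comm, Matrix.det_fin_two]
  have hVU : ∀ k l, (V * U) k l = U (if k = 0 then a else b) l := by
    intro k l
    fin_cases k <;> simp [V, Matrix.mul_apply]
  simp [hVU, U, hab, hab.symm]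

/-- The matrix `1 - P_σ diag(w)`, with `P_σ` the permutation matrix of `σ`. -/
noncomputable def cycleMatrix {A : Type*} [CommRing A] {n : ℕ} (w : Fin n → A)
    (σ : Equiv.Perm (Fin n)) : Matrix (Fin n) (Fin n) A :=
  Matrix.of fun i j => (if i = j then 1 else 0) - (if σ j = i then w j else 0)

theorem cycleMatrix_apply {A : Type*} [CommRing A] {n : ℕ} (w : Fin n → A)
    (σ : Equiv.Perm (Fin n)) (i j : Fin n) :
    cycleMatrix w σ i j = (if i = j then 1 else 0) - (if σ j = i then w j else 0) := rfl

open Equiv in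
theorem det_cycleMatrix_swap_mul {A : Type*} [CommRing A] {n : ℕ} (w : Fin n → A)
    (σ : Perm (Fin n)) (a : Fin n) (ha : σ a ≠ a) (hw : w a = 1) :
    (cycleMatrix (Function.update w a 0) (swap a (σ a) * σ)).det = (cycleMatrix w σ).det := by
  set c := σ⁻¹ a with hc
  have hσc : σ c = a := by simp [hc]
  have hca : c ≠ a := fun h => ha (by rw [← h, hσc, h])
  have key : cycleMatrix w σ * Matrix.transvection a c (w c) =
      Matrix.transvection (σ a) a (-1) *
        cycleMatrix (Function.update w a 0) (swap a (σ a) * σ) := by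
    ext i j
    simp only [Matrix.transvection, Matrix.mul_add, Matrix.add_mul, Matrix.mul_one, Matrix.one_mul,
      Matrix.add_apply]
    have hinj : ∀ x y, σ x = σ y ↔ x = y := fun x y => σ.injective.eq_iff
    have e1 : (cycleMatrix w σ * Matrix.single a c (w c)) i j =
        if j = c then cycleMatrix w σ i a * w c else 0 := by
      split_ifs with h
      · subst h; simp
      · rw [Matrix.mul_single_apply_of_ne _ _ _ _ _ h]
    have e2 : ((Matrix.single (σ a) a (-1) : Matrix (Fin n) (Fin n) A) *
        cycleMatrix (Function.update w a 0) (swap a (σ a) * σ)) i j =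
        if i = σ a then - cycleMatrix (Function.update w a 0) (swap a (σ a) * σ) a j else 0 := by
      split_ifs with h
      · subst h; simp
      · rw [Matrix.single_mul_apply_of_ne _ _ _ _ _ h]
    rw [e1, e2]
    simp only [cycleMatrix_apply, Perm.mul_apply]
    by_cases hja : j = a
    · subst hja
      simp [hca.symm, hw, eq_comm]
      grind
    · by_cases hjc : j = c
      · subst hjc
        simp [hσc, hca, hw]
        grind
      · have h1 : σ j ≠ a := fun h => hjc (σ.injective (h.trans hσc.symm))
        have h2 : σ j ≠ σ a := fun h => hja (σ.injective h)
        simp [hja, hjc, swap_apply_of_ne_of_ne h1 h2, h1, Ne.symm hja]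
  have := congrArg Matrix.det key
  rw [Matrix.det_mul, Matrix.det_mul, Matrix.det_transvection_of_ne _ _ hca.symm,
    Matrix.det_transvection_of_ne _ _ ha] at this
  simpa using this.symm

open Equiv in
theorem det_cycleMatrix_update {A : Type*} [CommRing A] {n : ℕ} (w : Fin n → A)
    (σ : Perm (Fin n)) (a : Fin n) (ha : σ a = a) (s : A) :
    (cycleMatrix (Function.update w a s) σ).det =
      (1 - s) * (cycleMatrix (Function.update w a 0) σ).det := by
  have : cycleMatrix (Function.update w a s) σ =
      (cycleMatrix (Function.update w a 0) σ).updateCol a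
        ((1 - s) • fun i => cycleMatrix (Function.update w a 0) σ i a) := by
    ext i j
    by_cases hj : j = a
    · subst hj
      simp only [Matrix.updateCol_self, cycleMatrix_apply, Pi.smul_apply, ha]
      by_cases h : j = i
      · subst h; simp
      · simp [h, Ne.symm h]
    · rw [Matrix.updateCol_ne hj]
      simp [cycleMatrix_apply, Function.update_of_ne hj]
  rw [this, Matrix.det_updateCol_smul]
  congr 2
  exact Matrix.updateCol_eq_self _ _

/-- Removing the non-fixed point `a` of weight `1` from its cycle. -/
theorem det_cycleMatrix_delete {A : Type*} [CommRing A] {n : ℕ} (w : Fin n → A)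
    (σ : Equiv.Perm (Fin n)) (a : Fin n) (ha : σ a ≠ a) (s : A) :
    (cycleMatrix (Function.update w a s) (Equiv.swap a (σ a) * σ)).det =
      (1 - s) * (cycleMatrix (Function.update w a 1) σ).det := by
  rw [det_cycleMatrix_update w _ a (by simp)]
  have := det_cycleMatrix_swap_mul (Function.update w a 1) σ a ha (by simp)
  rw [← this]
  simp

section Resolvent

variable {A : Type*} [CommRing A] {n : ℕ}

/-- `det (1 - t P_σ)`. -/
noncomputable def cycleDet (t : A) (σ : Equiv.Perm (Fin n)) : A :=
  (cycleMatrix (fun _ => t) σ).det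

theorem resolvent_apply_right {t : A} {σ : Equiv.Perm (Fin n)} {R : Matrix (Fin n) (Fin n) A}
    (hR : cycleMatrix (fun _ => t) σ * R = 1) (i j : Fin n) :
    t * R i (σ j) = R i j - if i = j then 1 else 0 := by
  have h : (R * cycleMatrix (fun _ => t) σ) i j = (1 : Matrix (Fin n) (Fin n) A) i j := by
    rw [mul_eq_one_comm.1 hR]
  rw [Matrix.mul_apply, Matrix.one_apply] at h
  simp only [cycleMatrix_apply, mul_sub, Finset.sum_sub_distrib] at h
  simp at h
  linear_combination -h

theorem resolvent_apply_left {t : A} {σ : Equiv.Perm (Fin n)} {R : Matrix (Fin n) (Fin n) A}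
    (hR : cycleMatrix (fun _ => t) σ * R = 1) (i j : Fin n) :
    R (σ i) j = t * R i j + if σ i = j then 1 else 0 := by
  have h : (cycleMatrix (fun _ => t) σ * R) (σ i) j = (1 : Matrix (Fin n) (Fin n) A) (σ i) j := by
    rw [hR]
  rw [Matrix.mul_apply, Matrix.one_apply] at h
  simp only [cycleMatrix_apply, sub_mul, Finset.sum_sub_distrib] at h
  simp at h
  linear_combination h

theorem resolvent_row_sum {t I : A} (hI : (1 - t) * I = 1) {σ : Equiv.Perm (Fin n)}
    {R : Matrix (Fin n) (Fin n) A} (hR : cycleMatrix (fun _ => t) σ * R = 1) (i : Fin n) :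
    ∑ j, R i j = I := by
  have h : ∑ j, t * R i (σ j) = ∑ j, (R i j - if i = j then 1 else 0) :=
    Finset.sum_congr rfl fun j _ => resolvent_apply_right hR i j
  rw [← Finset.mul_sum, Equiv.sum_comp σ (fun j => R i j), Finset.sum_sub_distrib] at h
  simp at h
  linear_combination (-I) * h - (∑ j, R i j) * hI

theorem resolvent_col_sum {t I : A} (hI : (1 - t) * I = 1) {σ : Equiv.Perm (Fin n)}
    {R : Matrix (Fin n) (Fin n) A} (hR : cycleMatrix (fun _ => t) σ * R = 1) (j : Fin n) :
    ∑ i, R i j = I := by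
  have h : ∑ i, R (σ i) j = ∑ i, (t * R i j + if σ i = j then 1 else 0) :=
    Finset.sum_congr rfl fun i _ => resolvent_apply_left hR i j
  rw [Equiv.sum_comp σ (fun i => R i j), Finset.sum_add_distrib, ← Finset.mul_sum,
    Equiv.sum_comp σ (fun i => if i = j then (1 : A) else 0)] at h
  simp at h
  linear_combination I * h - (∑ j_1, R j_1 j) * hI

theorem resolvent_fixed {t I : A} (hI : (1 - t) * I = 1) {σ : Equiv.Perm (Fin n)}
    {R : Matrix (Fin n) (Fin n) A} (hR : cycleMatrix (fun _ => t) σ * R = 1) {x : Fin n}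
    (hx : σ x = x) (i : Fin n) : R i x = if i = x then I else 0 := by
  have h := resolvent_apply_right hR i x
  rw [hx] at h
  split_ifs at h ⊢ with hi
  · linear_combination (-I) * h - R i x * hI
  · linear_combination (-I) * h - R i x * hI

theorem resolvent_fixed_left {t I : A} (hI : (1 - t) * I = 1) {σ : Equiv.Perm (Fin n)}
    {R : Matrix (Fin n) (Fin n) A} (hR : cycleMatrix (fun _ => t) σ * R = 1) {x : Fin n}
    (hx : σ x = x) (j : Fin n) : R x j = if x = j then I else 0 := by
  have h := resolvent_apply_left hR x j
  rw [hx] at h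
  split_ifs at h ⊢ with hi
  · linear_combination I * h - R x j * hI
  · linear_combination I * h - R x j * hI

theorem mulVec_single_sub {R : Matrix (Fin n) (Fin n) A} (a y : Fin n) (s : A) (i : Fin n) :
    R.mulVec (fun k => (if k = a then 1 else 0) - if y = k then s else 0) i
      = R i a - s * R i y := by
  simp [Matrix.mulVec, dotProduct, mul_sub, Finset.sum_sub_distrib, mul_comm]

theorem cycleMatrix_mul_swap (w : Fin n → A) (t : A) (σ : Equiv.Perm (Fin n)) {a b : Fin n}
    (hab : a ≠ b) (hw : ∀ x, x ≠ a → x ≠ b → w x = t) :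
    cycleMatrix w (σ * Equiv.swap a b) = ((cycleMatrix (fun _ => t) σ).updateCol a
      (fun k => (if k = a then 1 else 0) - if σ b = k then w a else 0)).updateCol b
      (fun k => (if k = b then 1 else 0) - if σ a = k then w b else 0) := by
  ext i j
  by_cases hj : j = b
  · subst hj; simp [cycleMatrix_apply]
  by_cases hj' : j = a
  · subst hj'; rw [Matrix.updateCol_ne hab]; simp [cycleMatrix_apply]
  rw [Matrix.updateCol_ne hj, Matrix.updateCol_ne hj', cycleMatrix_apply, cycleMatrix_apply,
    Equiv.Perm.mul_apply, Equiv.swap_apply_of_ne_of_ne hj' hj, hw j hj' hj]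

theorem det_cycleMatrix_mul_swap (w : Fin n → A) {t : A} {σ : Equiv.Perm (Fin n)}
    {R : Matrix (Fin n) (Fin n) A} (hR : cycleMatrix (fun _ => t) σ * R = 1) {a b : Fin n}
    (hab : a ≠ b) (hw : ∀ x, x ≠ a → x ≠ b → w x = t) :
    (cycleMatrix w (σ * Equiv.swap a b)).det = cycleDet t σ *
      ((R a a - w a * R a (σ b)) * (R b b - w b * R b (σ a)) -
        (R a b - w b * R a (σ a)) * (R b a - w a * R b (σ b))) := by
  rw [cycleMatrix_mul_swap w t σ hab hw, det_updateCol_updateCol _ R hR _ _ hab]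
  simp only [mulVec_single_sub]
  rfl

theorem cycleDet_mul_swap {t : A} {σ : Equiv.Perm (Fin n)}
    {R : Matrix (Fin n) (Fin n) A} (hR : cycleMatrix (fun _ => t) σ * R = 1) {a b : Fin n}
    (hab : a ≠ b) :
    cycleDet t (σ * Equiv.swap a b) =
      cycleDet t σ * (R a a + R b b - R a b - R b a - 1) := by
  rw [cycleDet, det_cycleMatrix_mul_swap _ hR hab (fun _ _ _ => rfl)]
  simp only [resolvent_apply_right hR, hab, hab.symm, if_true, if_false]
  ring

theorem cycleDet_mul_comm (t : A) (σ τ : Equiv.Perm (Fin n)) :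
    cycleDet t (σ * τ) = cycleDet t (τ * σ) := by
  have h : ∀ π : Equiv.Perm (Fin n), cycleMatrix (fun _ => t) π =
      1 - t • (π⁻¹).permMatrix A := by
    intro π
    ext i j
    simp only [cycleMatrix_apply, Matrix.sub_apply, Matrix.one_apply, Matrix.smul_apply,
      Equiv.Perm.permMatrix, PEquiv.toMatrix_apply, Equiv.toPEquiv_apply, Option.mem_def,
      Option.some.injEq, smul_eq_mul, mul_ite, mul_one, mul_zero, Equiv.Perm.inv_eq_iff_eq]
    simp only [eq_comm]
  have h2 : ∀ π ρ : Equiv.Perm (Fin n),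
      t • ((π * ρ)⁻¹).permMatrix A = (t • (π⁻¹).permMatrix A) * (ρ⁻¹).permMatrix A := by
    intro π ρ
    rw [Matrix.smul_mul, mul_inv_rev, Matrix.permMatrix_mul]
  rw [cycleDet, cycleDet, h, h, h2, Matrix.det_one_sub_mul_comm, Matrix.mul_smul,
    ← Matrix.permMatrix_mul, mul_inv_rev]

/-- The sum over all transpositions moving `d` inside a set `S` outside of which `σ` is trivial. -/
theorem sum_cycleDet_swap_mul {t I : A} (hI : (1 - t) * I = 1) {σ : Equiv.Perm (Fin n)}
    {R : Matrix (Fin n) (Fin n) A} (hR : cycleMatrix (fun _ => t) σ * R = 1)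
    (S : Finset (Fin n)) (hS : ∀ x ∉ S, σ x = x) {d : Fin n} (hd : d ∈ S) :
    ∑ x ∈ S.erase d, cycleDet t (Equiv.swap d x * σ) =
      cycleDet t σ * (S.card * R d d + R.trace - (n - S.card) * I - 2 * I - S.card + 1) := by
  have h1 : ∀ x ∈ S.erase d, cycleDet t (Equiv.swap d x * σ) =
      cycleDet t σ * (R d d + R x x - R d x - R x d - 1) := by
    intro x hx
    rw [cycleDet_mul_comm, cycleDet_mul_swap hR (Finset.ne_of_mem_erase hx).symm]
  rw [Finset.sum_congr rfl h1, ← Finset.mul_sum]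
  congr 1
  have h2 := Finset.add_sum_erase S (fun x => R d d + R x x - R d x - R x d - 1) hd
  have h3 : ∑ x ∈ S, R d x = I := by
    rw [← resolvent_row_sum hI hR d]
    refine Finset.sum_subset (Finset.subset_univ S) fun x _ hx => ?_
    rw [resolvent_fixed hI hR (hS x hx), if_neg (by rintro rfl; exact hx hd)]
  have h4 : ∑ x ∈ S, R x d = I := by
    rw [← resolvent_col_sum hI hR d]
    refine Finset.sum_subset (Finset.subset_univ S) fun x _ hx => ?_
    rw [resolvent_fixed_left hI hR (hS x hx), if_neg (by rintro rfl; exact hx hd)]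
  have h5 : ∑ x ∈ S, R x x + (n - S.card) * I = R.trace := by
    rw [Matrix.trace, ← Finset.sum_add_sum_compl S]
    congr 1
    have : ∀ x ∈ Sᶜ, R.diag x = I := by
      intro x hx
      rw [Matrix.diag_apply, resolvent_fixed hI hR (hS x (Finset.mem_compl.1 hx)), if_pos rfl]
    rw [Finset.sum_congr rfl this, Finset.sum_const, Finset.card_compl, Fintype.card_fin,
      nsmul_eq_mul, Nat.cast_sub (by simpa using Finset.card_le_univ S)]
  simp only [Finset.sum_sub_distrib, Finset.sum_add_distrib, Finset.sum_const, nsmul_eq_mul,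
    mul_one] at h2 h3 h4 h5 ⊢
  linear_combination h2 - h3 - h4 + h5

theorem det_delete_both {t : A} {σ : Equiv.Perm (Fin n)}
    {R : Matrix (Fin n) (Fin n) A} (hR : cycleMatrix (fun _ => t) σ * R = 1) {a b : Fin n}
    (hab : a ≠ b) :
    t ^ 2 * (cycleMatrix (Function.update (Function.update (fun _ => t) a 1) b 1)
      (σ * Equiv.swap a b)).det = cycleDet t σ *
        (t ^ 2 * (R a a * R b b - R a b * R b a) + R a b * R b a - (R a a - 1) * (R b b - 1)
          - t * (R a b + R b a)) := by
  rw [det_cycleMatrix_mul_swap _ hR hab (fun x h h' => by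
    rw [Function.update_of_ne h', Function.update_of_ne h])]
  simp only [Function.update_self, Function.update_of_ne hab, one_mul]
  have h1 := resolvent_apply_right hR a b
  have h2 := resolvent_apply_right hR b a
  have h3 := resolvent_apply_right hR a a
  have h4 := resolvent_apply_right hR b b
  simp only [hab, hab.symm, if_true, if_false, sub_zero] at h1 h2 h3 h4
  rw [mul_left_comm]
  congr 1
  calc _ = (t * R a a - t * R a (σ b)) * (t * R b b - t * R b (σ a)) -
        (t * R a b - t * R a (σ a)) * (t * R b a - t * R b (σ b)) := by ring
    _ = _ := by rw [h1, h2, h3, h4]; ring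

theorem det_delete_adjacent {t : A} {σ : Equiv.Perm (Fin n)}
    {R : Matrix (Fin n) (Fin n) A} (hR : cycleMatrix (fun _ => t) σ * R = 1) {a : Fin n}
    (ha : a ≠ σ a) :
    t ^ 2 * (cycleMatrix (Function.update (fun _ => t) a 1) (σ * Equiv.swap a (σ a))).det =
      (1 - t) * cycleDet t σ * (t ^ 2 * R a a - (R a a - 1)) := by
  rw [det_cycleMatrix_mul_swap _ hR ha (fun x h _ => Function.update_of_ne h _ _)]
  simp only [Function.update_self, Function.update_of_ne ha.symm, one_mul]
  have h1 := resolvent_apply_right hR a (σ a)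
  have h2 := resolvent_apply_right hR (σ a) (σ a)
  have h3 := resolvent_apply_right hR a a
  have h4 := resolvent_apply_left hR a a
  have h5 := resolvent_apply_left hR a (σ a)
  simp only [ha, ha.symm, if_true, if_false, sub_zero, add_zero] at h1 h2 h3 h4 h5
  have h6 : R (σ a) (σ a) = R a a := by rw [h5, h3]; ring
  rw [h6] at h2 ⊢
  have h7 : t ^ 2 * ((R a a - R a (σ (σ a))) * (R a a - t * R a a) -
      (R a (σ a) - t * R a (σ a)) * (R (σ a) a - R (σ a) (σ (σ a)))) =
      (1 - t) * (t ^ 2 * R a a - (R a a - 1)) := by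
    rw [h4]
    linear_combination (exp := 1) (-(1 - t) * t * R a a) * h1 + (1 - t) * t * R a (σ a) * h2 +
      (1 - t) * (- t ^ 2 * R a a - 1) * h3
  linear_combination cycleDet t σ * h7

theorem delete_both_factor_adjacent {t : A} {σ : Equiv.Perm (Fin n)}
    {R : Matrix (Fin n) (Fin n) A} (hR : cycleMatrix (fun _ => t) σ * R = 1) {a : Fin n}
    (ha : a ≠ σ a) :
    t ^ 2 * (R a a * R (σ a) (σ a) - R a (σ a) * R (σ a) a) + R a (σ a) * R (σ a) a -
      (R a a - 1) * (R (σ a) (σ a) - 1) - t * (R a (σ a) + R (σ a) a) = 0 := by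
  have h3 := resolvent_apply_right hR a a
  have h4 := resolvent_apply_left hR a a
  have h5 := resolvent_apply_left hR a (σ a)
  simp only [ha.symm, if_true, if_false, add_zero] at h3 h4 h5
  have h6 : R (σ a) (σ a) = R a a := by rw [h5, h3]; ring
  rw [h6, h4]
  linear_combination ((1 - t ^ 2) * R a a - 1) * h3

theorem derivation_cycleDet {K : Type*} [CommSemiring K] [Algebra K A]
    (D : Derivation K A A) {t : A} (ht : D t = 1)
    {σ : Equiv.Perm (Fin n)} {R : Matrix (Fin n) (Fin n) A}
    (hR : cycleMatrix (fun _ => t) σ * R = 1) :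
    t * D (cycleDet t σ) = cycleDet t σ * (n - R.trace) := by
  have hadj : (cycleMatrix (fun _ => t) σ).adjugate = cycleDet t σ • R := by
    calc _ = (cycleMatrix (fun _ => t) σ).adjugate * (cycleMatrix (fun _ => t) σ * R) := by
          rw [hR, Matrix.mul_one]
      _ = _ := by rw [← Matrix.mul_assoc, Matrix.adjugate_mul, Matrix.smul_mul, Matrix.one_mul]; rfl
  rw [cycleDet, derivation_det, hadj, Matrix.smul_mul, Matrix.trace_smul, smul_eq_mul,
    mul_left_comm]
  congr 1
  have h : ∀ j, t * (R * (cycleMatrix (fun _ => t) σ).map D) j j = 1 - R j j := by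
    intro j
    have : ∀ k, D (cycleMatrix (fun _ => t) σ k j) = if σ j = k then -1 else 0 := by
      intro k
      rw [cycleMatrix_apply, map_sub]
      split_ifs <;> simp [ht]
    simp only [Matrix.mul_apply, Matrix.map_apply, this]
    simp
    have := resolvent_apply_right hR j j
    simp at this
    linear_combination -this
  simp only [Matrix.trace, Finset.mul_sum, Matrix.diag_apply, h, Finset.sum_sub_distrib]
  simp

theorem derivation_trace_resolvent {K : Type*} [CommSemiring K] [Algebra K A]
    (D : Derivation K A A) {t : A} (ht : D t = 1)
    {σ : Equiv.Perm (Fin n)} {R : Matrix (Fin n) (Fin n) A}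
    (hR : cycleMatrix (fun _ => t) σ * R = 1) :
    t * D R.trace = (R * R).trace - R.trace := by
  have hR' := mul_eq_one_comm.1 hR
  set M := cycleMatrix (fun _ => t) σ with hM
  have h0 : M.map D * R + M * R.map D = 0 := by
    ext i j
    have := congrArg D (congrFun (congrFun hR i) j)
    rw [Matrix.mul_apply, map_sum] at this
    simp only [D.leibniz, smul_eq_mul, Finset.sum_add_distrib] at this
    rw [Matrix.add_apply, Matrix.mul_apply, Matrix.mul_apply]
    simp only [Matrix.map_apply]
    have h1 : D ((1 : Matrix (Fin n) (Fin n) A) i j) = 0 := by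
      rw [Matrix.one_apply]; split_ifs <;> simp
    rw [h1] at this
    rw [Matrix.zero_apply, ← this, add_comm]
    simp only [mul_comm]
  have h1 : R.map D = - (R * M.map D * R) := by
    have := congrArg (R * ·) h0
    simp only [Matrix.mul_add, ← Matrix.mul_assoc, hR', Matrix.one_mul, Matrix.mul_zero] at this
    exact eq_neg_of_add_eq_zero_right this
  have h2 : t • M.map D = M - 1 := by
    ext i j
    simp only [Matrix.smul_apply, Matrix.map_apply, Matrix.sub_apply, Matrix.one_apply, hM,
      cycleMatrix_apply, map_sub, smul_eq_mul]
    split_ifs <;> simp [ht]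
  have h3 : t • R.map D = R * R - R := by
    rw [h1, smul_neg, ← Matrix.smul_mul, ← Matrix.mul_smul, h2, Matrix.mul_sub, hR', Matrix.mul_one,
      Matrix.sub_mul, Matrix.one_mul, neg_sub]
  have h4 : D R.trace = (R.map D).trace := by
    simp [Matrix.trace, map_sum]
  rw [h4, ← smul_eq_mul, ← Matrix.trace_smul, h3, Matrix.trace_sub]

end Resolvent

section Series

/-- The formal derivative on `ℂ⟦X⟧`. -/
noncomputable def serD : Derivation ℂ (PowerSeries ℂ) (PowerSeries ℂ) :=
  PowerSeries.derivative ℂ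

/-- The geometric series `(1 - X)⁻¹`. -/
noncomputable def geomSer : PowerSeries ℂ := PowerSeries.mk 1

theorem one_sub_mul_geomSer : (1 - PowerSeries.X) * geomSer = 1 := by
  rw [mul_comm]; exact PowerSeries.mk_one_mul_one_sub_eq_one ℂ

theorem serD_X : serD PowerSeries.X = 1 := PowerSeries.derivative_X

theorem serD_geomSer : serD geomSer = geomSer ^ 2 := by
  have h := congrArg serD one_sub_mul_geomSer
  rw [serD.leibniz, map_sub, serD_X, Derivation.map_one_eq_zero, smul_eq_mul, smul_eq_mul] at h
  linear_combination geomSer * h - serD geomSer * one_sub_mul_geomSer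

theorem X_mul_serD_mk (f : ℕ → ℂ) :
    PowerSeries.X * serD (PowerSeries.mk f) = PowerSeries.mk fun q => (q : ℂ) * f q := by
  ext q
  cases q with
  | zero => simp
  | succ q =>
    rw [PowerSeries.coeff_succ_X_mul]
    change PowerSeries.coeff q (PowerSeries.derivative ℂ _) = _
    rw [PowerSeries.coeff_derivative]
    simp [mul_comm]

theorem exists_resolvent {n : ℕ} (σ : Equiv.Perm (Fin n)) :
    ∃ R : Matrix (Fin n) (Fin n) (PowerSeries ℂ),
      cycleMatrix (fun _ => PowerSeries.X) σ * R = 1 := by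
  have h : IsUnit (cycleMatrix (fun _ => (PowerSeries.X : PowerSeries ℂ)) σ).det := by
    rw [PowerSeries.isUnit_iff_constantCoeff, RingHom.map_det]
    have : (PowerSeries.constantCoeff (R := ℂ)).mapMatrix
        (cycleMatrix (fun _ => (PowerSeries.X : PowerSeries ℂ)) σ) = 1 := by
      ext i j
      rw [RingHom.mapMatrix_apply, Matrix.map_apply, cycleMatrix_apply, Matrix.one_apply, map_sub]
      split_ifs <;> simp
    rw [this, Matrix.det_one]
    exact isUnit_one
  exact ⟨_, Matrix.mul_nonsing_inv _ h⟩

theorem cycleDet_one {A : Type*} [CommRing A] (n : ℕ) (t : A) :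
    cycleDet t (1 : Equiv.Perm (Fin n)) = (1 - t) ^ n := by
  have : cycleMatrix (fun _ => t) (1 : Equiv.Perm (Fin n)) = Matrix.diagonal fun _ => 1 - t := by
    ext i j
    rw [cycleMatrix_apply, Matrix.diagonal_apply, Equiv.Perm.one_apply]
    by_cases h : i = j
    · simp [h]
    · simp [h, Ne.symm h]
  rw [cycleDet, this, Matrix.det_diagonal]
  simp

end Series

section Cyc

variable {n : ℕ}

/-- The permutations forming a single cycle on `S` and trivial outside `S`. -/
noncomputable def cyc (S : Finset (Fin n)) : Finset (Equiv.Perm (Fin n)) :=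
  Finset.univ.filter fun γ => (∀ x ∉ S, γ x = x) ∧ numCycles γ = n - S.card + 1

theorem mem_cyc {S : Finset (Fin n)} {γ : Equiv.Perm (Fin n)} :
    γ ∈ cyc S ↔ (∀ x ∉ S, γ x = x) ∧ numCycles γ = n - S.card + 1 := by
  simp [cyc]

theorem apply_ne_of_mem_cyc {S : Finset (Fin n)} {γ : Equiv.Perm (Fin n)} (hγ : γ ∈ cyc S)
    {a : Fin n} (ha : a ∈ S) (hS : 2 ≤ S.card) : γ a ≠ a := by
  intro h
  have hn : S.card ≤ n := by simpa using Finset.card_le_univ S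
  have hc : (S.erase a)ᶜ.card = n - S.card + 1 := by
    rw [Finset.card_compl, Fintype.card_fin, Finset.card_erase_of_mem ha]; omega
  have := card_lt_numCycles γ (S.erase a)ᶜ (by
    intro x hx
    by_cases hxa : x = a
    · rw [hxa, h]
    · exact (mem_cyc.1 hγ).1 x (by simpa [hxa] using hx)) (by
    intro h'
    have := congrArg Finset.card h'
    rw [hc, Finset.card_univ, Fintype.card_fin] at this
    omega)
  rw [hc, (mem_cyc.1 hγ).2] at this
  exact lt_irrefl _ this

theorem swap_mul_mul_swap (γ : Equiv.Perm (Fin n)) {a : Fin n} (ha : γ a = a) (x : Fin n) :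
    Equiv.swap a (γ x) * (γ * Equiv.swap a x) = γ := by
  rw [← mul_assoc, mul_assoc, Equiv.mul_swap_eq_swap_mul, ha, ← mul_assoc,
    Equiv.swap_mul_self, one_mul]

theorem sum_cyc_eq {B : Type*} [AddCommMonoid B] {S : Finset (Fin n)} {a : Fin n} (ha : a ∈ S)
    (hS : 2 ≤ S.card) (f : Equiv.Perm (Fin n) → B) :
    ∑ γ ∈ cyc S, f γ = ∑ x ∈ S.erase a, ∑ γ ∈ cyc (S.erase a), f (γ * Equiv.swap a x) := by
  have hn : S.card ≤ n := by simpa using Finset.card_le_univ S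
  rw [← Finset.sum_product']
  symm
  refine Finset.sum_nbij' (fun p => p.2 * Equiv.swap a p.1)
    (fun γ => (γ⁻¹ a, γ * Equiv.swap a (γ⁻¹ a))) ?_ ?_ ?_ ?_ ?_
  · rintro ⟨x, γ⟩ h
    obtain ⟨hx, hγ⟩ := Finset.mem_product.1 h
    dsimp only at hx hγ ⊢
    rw [mem_cyc] at hγ ⊢
    have hγa : γ a = a := hγ.1 a (by simp)
    have hxa := Finset.ne_of_mem_erase hx
    refine ⟨fun y hy => ?_, ?_⟩
    · have h1 : y ≠ a := by rintro rfl; exact hy ha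
      have h2 : y ≠ x := by rintro rfl; exact hy (Finset.mem_of_mem_erase hx)
      rw [Equiv.Perm.mul_apply, Equiv.swap_apply_of_ne_of_ne h1 h2]
      exact hγ.1 y (by simp [hy])
    · have h1 : (γ * Equiv.swap a x) a = γ x := by simp
      have h2 := numCycles_swap_mul (γ * Equiv.swap a x) a (by
        rw [h1]; intro h; exact hxa (γ.injective (h.trans hγa.symm)))
      rw [h1, swap_mul_mul_swap γ hγa, hγ.2, Finset.card_erase_of_mem ha] at h2
      omega
  · intro γ hγ
    have hne := apply_ne_of_mem_cyc hγ ha hS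
    rw [mem_cyc] at hγ
    rw [Finset.mem_product]
    dsimp only
    have hx : γ⁻¹ a ≠ a := by
      intro h; exact hne (by rw [← Equiv.Perm.inv_eq_iff_eq.1 h])
    have hx' : γ⁻¹ a ∈ S := by
      by_contra h
      have := hγ.1 _ h
      simp at this
      exact h (this ▸ ha)
    refine ⟨Finset.mem_erase.2 ⟨hx, hx'⟩, mem_cyc.2 ⟨fun y hy => ?_, ?_⟩⟩
    · by_cases hya : y = a
      · simp [hya]
      · have hyS : y ∉ S := fun h => hy (Finset.mem_erase.2 ⟨hya, h⟩)
        rw [Equiv.Perm.mul_apply, Equiv.swap_apply_of_ne_of_ne hya (by rintro rfl; exact hyS hx')]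
        exact hγ.1 y hyS
    · rw [Equiv.mul_swap_eq_swap_mul, (by simp : γ (γ⁻¹ a) = a), Equiv.swap_comm,
        numCycles_swap_mul γ a hne, hγ.2, Finset.card_erase_of_mem ha]
      omega
  · rintro ⟨x, γ⟩ h
    obtain ⟨hx, hγ⟩ := Finset.mem_product.1 h
    have hγa : Equiv.symm γ a = a := by
      rw [Equiv.symm_apply_eq]; exact ((mem_cyc.1 hγ).1 a (by simp)).symm
    simp [mul_assoc, hγa]
  · intro γ hγ
    simp [mul_assoc]
  · intro p hp
    rfl

/-- The generating series in `q` of `∑ q ^ κ(γ τ)` over `γ ∈ cyc S`, with the fixed points outside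
`S` not counted. -/
noncomputable def cycSeries (S : Finset (Fin n)) (τ : Equiv.Perm (Fin n)) : PowerSeries ℂ :=
  PowerSeries.mk fun q => ∑ γ ∈ cyc S, (q : ℂ) ^ (numCycles (γ * τ) - (n - S.card))

theorem cycSeries_eq_sum {S : Finset (Fin n)} (τ : Equiv.Perm (Fin n)) :
    cycSeries S τ = ∑ γ ∈ cyc S,
      PowerSeries.mk fun q => (q : ℂ) ^ (numCycles (γ * τ) - (n - S.card)) := by
  ext q
  simp [cycSeries]

theorem cycSeries_of_fixed {S : Finset (Fin n)} {τ : Equiv.Perm (Fin n)} {a : Fin n} (ha : a ∈ S)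
    (hS : 2 ≤ S.card) (hτa : τ a = a) :
    cycSeries S τ = (S.card - 1 : ℕ) * cycSeries (S.erase a) τ := by
  have hn : S.card ≤ n := by simpa using Finset.card_le_univ S
  rw [cycSeries_eq_sum, sum_cyc_eq ha hS, cycSeries_eq_sum]
  have : ∀ x ∈ S.erase a, ∑ γ ∈ cyc (S.erase a), (PowerSeries.mk fun q : ℕ =>
      (q : ℂ) ^ (numCycles (γ * Equiv.swap a x * τ) - (n - S.card))) =
      ∑ γ ∈ cyc (S.erase a), (PowerSeries.mk fun q : ℕ =>
        (q : ℂ) ^ (numCycles (γ * τ) - (n - (S.erase a).card))) := by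
    intro x hx
    refine Finset.sum_congr rfl fun γ hγ => ?_
    have hγa : γ a = a := (mem_cyc.1 hγ).1 a (by simp)
    have h1 : (γ * Equiv.swap a x * τ) a = γ x := by simp [hτa]
    have h2 := numCycles_swap_mul (γ * Equiv.swap a x * τ) a (by
      rw [h1]; intro h; exact Finset.ne_of_mem_erase hx (γ.injective (h.trans hγa.symm)))
    rw [h1, ← mul_assoc, swap_mul_mul_swap γ hγa] at h2
    have h3 : numCycles (γ * Equiv.swap a x * τ) - (n - S.card) =
        numCycles (γ * τ) - (n - (S.erase a).card) := by
      rw [Finset.card_erase_of_mem ha]; omega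
    rw [h3]
  rw [Finset.sum_congr rfl this, Finset.sum_const, Finset.card_erase_of_mem ha, nsmul_eq_mul]

theorem cycSeries_of_ne {S : Finset (Fin n)} {τ : Equiv.Perm (Fin n)} {a : Fin n} (ha : a ∈ S)
    (hS : 2 ≤ S.card) (hτ : ∀ x ∉ S, τ x = x) (hτa : τ a ≠ a) :
    cycSeries S τ =
      PowerSeries.X * serD (cycSeries (S.erase a) (Equiv.swap a (τ a) * τ)) +
      ∑ x ∈ (S.erase a).erase (τ a),
        cycSeries (S.erase a) (Equiv.swap (τ a) x * (Equiv.swap a (τ a) * τ)) := by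
  have hn : S.card ≤ n := by simpa using Finset.card_le_univ S
  have hd : τ a ∈ S.erase a := by
    refine Finset.mem_erase.2 ⟨hτa, ?_⟩
    by_contra h
    exact hτa (τ.injective (hτ _ h))
  set d := τ a with hdef
  set τ' := Equiv.swap a d * τ with hτ'
  rw [cycSeries_eq_sum, sum_cyc_eq ha hS, ← Finset.add_sum_erase _ _ hd]
  congr 1
  · rw [cycSeries, X_mul_serD_mk]
    ext q
    simp only [map_sum, PowerSeries.coeff_mk, Finset.mul_sum]
    refine Finset.sum_congr rfl fun γ hγ => ?_
    rw [mul_assoc, ← hτ', ← pow_succ']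
    congr 1
    have := card_lt_numCycles (γ * τ') (S.erase a)ᶜ (by
      intro x hx
      have hx' := Finset.mem_compl.1 hx
      have : τ' x = x := by
        by_cases hxa : x = a
        · rw [hxa, hτ', Equiv.Perm.mul_apply, ← hdef, Equiv.swap_apply_right]
        · have hxS : x ∉ S := fun h => hx' (Finset.mem_erase.2 ⟨hxa, h⟩)
          rw [hτ', Equiv.Perm.mul_apply, hτ x hxS, Equiv.swap_apply_of_ne_of_ne hxa]
          rintro rfl; exact hx' hd
      rw [Equiv.Perm.mul_apply, this]
      exact (mem_cyc.1 hγ).1 x hx') (by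
      intro h
      have := Finset.mem_univ d
      rw [← h] at this
      exact Finset.mem_compl.1 this hd)
    rw [Finset.card_compl, Fintype.card_fin, Finset.card_erase_of_mem ha] at this
    rw [Finset.card_erase_of_mem ha]
    omega
  · refine Finset.sum_congr rfl fun x hx => ?_
    rw [cycSeries_eq_sum]
    refine Finset.sum_congr rfl fun γ hγ => ?_
    have hγa : γ a = a := (mem_cyc.1 hγ).1 a (by simp)
    have hxd := Finset.ne_of_mem_erase hx
    have hxa := Finset.ne_of_mem_erase (Finset.mem_of_mem_erase hx)
    have h1 : (γ * Equiv.swap a x * τ) a = γ d := by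
      rw [Equiv.Perm.mul_apply, Equiv.Perm.mul_apply, ← hdef,
        Equiv.swap_apply_of_ne_of_ne hτa hxd.symm]
    have h2 := numCycles_swap_mul (γ * Equiv.swap a x * τ) a (by
      rw [h1]; intro h; exact hτa (γ.injective (h.trans hγa.symm)))
    have h3 : Equiv.swap a (γ d) * (γ * Equiv.swap a x * τ) = γ * (Equiv.swap d x * τ') := by
      have h4 : Equiv.swap a (γ d) * γ = γ * Equiv.swap a d := by
        rw [Equiv.mul_swap_eq_swap_mul, hγa]
      have h5 : Equiv.swap a d * Equiv.swap a x = Equiv.swap d x * Equiv.swap a d := by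
        rw [Equiv.mul_swap_eq_swap_mul, Equiv.swap_apply_left,
          Equiv.swap_apply_of_ne_of_ne hxa hxd]
      rw [← mul_assoc, ← mul_assoc, h4, mul_assoc γ, h5, hτ', mul_assoc, mul_assoc]
    rw [h1, h3] at h2
    have h6 : numCycles (γ * Equiv.swap a x * τ) - (n - S.card) =
        numCycles (γ * (Equiv.swap d x * τ')) - (n - (S.erase a).card) := by
      rw [Finset.card_erase_of_mem ha]; omega
    rw [h6]

theorem cycSeries_eq {S : Finset (Fin n)} {τ : Equiv.Perm (Fin n)} (hne : S.Nonempty)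
    (hτ : ∀ x ∉ S, τ x = x) :
    cycSeries S τ = ((S.card - 1).factorial : PowerSeries ℂ) *
      (PowerSeries.X * cycleDet PowerSeries.X τ * geomSer ^ (n + 2)) := by
  have hI := one_sub_mul_geomSer
  induction hN : S.card - 1 generalizing S τ with
  | zero =>
    have hS : S.card = 1 := by have := hne.card_pos; omega
    obtain ⟨a, rfl⟩ := Finset.card_eq_one.1 hS
    have hn : 1 ≤ n := by have := a.2; omega
    have hfix : ∀ γ : Equiv.Perm (Fin n), (∀ x ∉ ({a} : Finset (Fin n)), γ x = x) → γ = 1 := by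
      intro γ h
      have h0 : ∀ x, x ≠ a → γ x = x := fun x hx => h x (by simpa using hx)
      ext x
      by_cases hx : x = a
      · subst hx
        rw [Equiv.Perm.one_apply]
        by_contra hc
        have hc' : γ x ≠ x := fun h => hc (by rw [h])
        exact hc' (γ.injective (h0 _ hc'))
      · rw [h0 x hx, Equiv.Perm.one_apply]
    have h1 : numCycles (1 : Equiv.Perm (Fin n)) = n := by simp [numCycles_eq]
    have hcyc : cyc ({a} : Finset (Fin n)) = {1} := by
      ext γ
      rw [mem_cyc, Finset.mem_singleton]
      refine ⟨fun h => hfix γ h.1, ?_⟩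
      rintro rfl
      refine ⟨fun _ _ => rfl, ?_⟩
      rw [h1, Finset.card_singleton]; omega
    obtain rfl := hfix τ hτ
    rw [cycSeries, hcyc, cycleDet_one]
    simp only [Finset.sum_singleton, mul_one, h1, Finset.card_singleton,
      Nat.sub_sub_self hn, pow_one]
    have h2 : (PowerSeries.mk fun q : ℕ => (q : ℂ)) = PowerSeries.X * geomSer ^ 2 := by
      rw [← serD_geomSer, geomSer, X_mul_serD_mk]
      simp
    have h3 : (1 - PowerSeries.X) ^ n * geomSer ^ n = 1 := by rw [← mul_pow, hI, one_pow]
    rw [h2]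
    simp only [Nat.factorial_zero, Nat.cast_one, one_mul]
    linear_combination (-PowerSeries.X * geomSer ^ 2) * h3
  | succ N ih =>
    have hS : 2 ≤ S.card := by omega
    obtain ⟨a, ha⟩ := hne
    have hcard : (S.erase a).card = N + 1 := by rw [Finset.card_erase_of_mem ha]; omega
    have hne' : (S.erase a).Nonempty := by rw [← Finset.card_pos]; omega
    have hfac : (((N + 1).factorial : ℕ) : PowerSeries ℂ) =
        ((N : PowerSeries ℂ) + 1) * (N.factorial : ℕ) := by
      rw [Nat.factorial_succ]; push_cast; ring
    have ih' : ∀ σ : Equiv.Perm (Fin n), (∀ x ∉ S.erase a, σ x = x) →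
        cycSeries (S.erase a) σ = (N.factorial : PowerSeries ℂ) *
          (PowerSeries.X * cycleDet PowerSeries.X σ * geomSer ^ (n + 2)) :=
        fun σ hσ => ih hne' hσ (by omega)
    by_cases hτa : τ a = a
    · rw [cycSeries_of_fixed ha hS hτa, hN, ih' τ, hfac]
      · push_cast; ring
      · intro x hx
        by_cases hxa : x = a
        · rw [hxa, hτa]
        · exact hτ x fun h => hx (Finset.mem_erase.2 ⟨hxa, h⟩)
    · have hd : τ a ∈ S.erase a := by
        refine Finset.mem_erase.2 ⟨hτa, ?_⟩
        by_contra h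
        exact hτa (τ.injective (hτ _ h))
      rw [cycSeries_of_ne ha hS hτ hτa]
      set d := τ a with hdef
      set τ' := Equiv.swap a d * τ with hτ'
      have hττ' : τ = Equiv.swap a d * τ' := by
        rw [hτ', ← mul_assoc, Equiv.swap_mul_self, one_mul]
      have hτ'a : τ' a = a := by
        rw [hτ', Equiv.Perm.mul_apply, ← hdef, Equiv.swap_apply_right]
      have hfix : ∀ x ∉ S.erase a, τ' x = x := by
        intro x hx'
        by_cases hxa : x = a
        · rw [hxa, hτ'a]
        · have hxS : x ∉ S := fun h => hx' (Finset.mem_erase.2 ⟨hxa, h⟩)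
          rw [hτ', Equiv.Perm.mul_apply, hτ x hxS, Equiv.swap_apply_of_ne_of_ne hxa]
          rintro rfl; exact hx' hd
      obtain ⟨R, hR⟩ := exists_resolvent τ'
      have hsum : ∑ x ∈ (S.erase a).erase d, cycSeries (S.erase a) (Equiv.swap d x * τ') =
          (N.factorial : PowerSeries ℂ) * PowerSeries.X * geomSer ^ (n + 2) *
          ∑ x ∈ (S.erase a).erase d, cycleDet PowerSeries.X (Equiv.swap d x * τ') := by
        rw [Finset.mul_sum]
        refine Finset.sum_congr rfl fun x hx => ?_
        rw [ih']
        · ring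
        · intro y hy
          rw [Equiv.Perm.mul_apply, hfix y hy, Equiv.swap_apply_of_ne_of_ne]
          · rintro rfl; exact hy hd
          · rintro rfl; exact hy (Finset.mem_of_mem_erase hx)
      have hG : cycleDet PowerSeries.X τ = cycleDet PowerSeries.X τ' * (R d d + geomSer - 1) := by
        rw [hττ', cycleDet_mul_comm, cycleDet_mul_swap hR (Ne.symm hτa),
          resolvent_fixed hI hR hτ'a, resolvent_fixed hI hR hτ'a,
          resolvent_fixed_left hI hR hτ'a, if_pos rfl, if_neg hτa, if_neg (Ne.symm hτa)]
        ring
      have hDG := derivation_cycleDet serD serD_X hR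
      rw [ih' τ' hfix, hsum, sum_cycleDet_swap_mul hI hR _ hfix hd, hG, hfac, hcard]
      simp only [Derivation.leibniz, Derivation.leibniz_pow, Derivation.map_natCast, serD_X,
        serD_geomSer, smul_eq_mul, nsmul_eq_mul]
      generalize cycleDet (PowerSeries.X : PowerSeries ℂ) τ' = G at *
      have hsub : n + 2 - 1 = n + 1 := rfl
      rw [hsub]
      push_cast
      linear_combination ((N.factorial : PowerSeries ℂ) * PowerSeries.X * geomSer ^ (n + 2)) * hDG
        - ((N.factorial : PowerSeries ℂ) * PowerSeries.X * geomSer ^ (n + 2) * G * (n + 2)) * hI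

end Cyc

section Class

variable {n : ℕ}

theorem fullCycleType_conj (σ τ : Equiv.Perm (Fin n)) :
    fullCycleType (σ * τ * σ⁻¹) = fullCycleType τ := by
  simp [fullCycleType, Equiv.Perm.cycleType_conj]

theorem numCycles_mul_comm (σ τ : Equiv.Perm (Fin n)) : numCycles (σ * τ) = numCycles (τ * σ) := by
  have := fullCycleType_conj τ (σ * τ)
  rw [numCycles, numCycles, ← this]
  simp [mul_assoc]

theorem fullCycleType_eq_two_iff (hn : 6 ≤ n) (α : Equiv.Perm (Fin n)) :
    fullCycleType α = {2, n - 2} ↔ α.cycleType = {2, n - 2} := by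
  constructor
  · intro h
    have h1 : n - α.cycleType.sum = 0 := by
      by_contra hne
      have : 1 ∈ fullCycleType α := by
        rw [fullCycleType, Multiset.mem_add]
        exact Or.inr (Multiset.mem_replicate.2 ⟨hne, rfl⟩)
      rw [h] at this
      simp at this
      omega
    simpa [fullCycleType, h1] using h
  · intro h
    have h1 : n - α.cycleType.sum = 0 := by rw [h]; simp; omega
    rw [fullCycleType, h1, h]; simp

theorem card_pair_compl {a b : Fin n} (hab : a ≠ b) : ({a, b}ᶜ : Finset (Fin n)).card = n - 2 := by
  rw [Finset.card_compl, Fintype.card_fin, Finset.card_pair hab]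

theorem cycleType_swap_mul_of_mem_cyc (hn : 6 ≤ n) {a b : Fin n} (hab : a ≠ b)
    {γ : Equiv.Perm (Fin n)} (hγ : γ ∈ cyc ({a, b}ᶜ : Finset (Fin n))) :
    (Equiv.swap a b * γ).cycleType = {2, n - 2} := by
  have hS := card_pair_compl hab
  have hfix := (mem_cyc.1 hγ).1
  have hsupp : γ.support = {a, b}ᶜ := by
    ext x
    rw [Equiv.Perm.mem_support]
    constructor
    · intro h
      by_contra hx
      exact h (hfix x hx)
    · intro hx
      exact apply_ne_of_mem_cyc hγ hx (by omega)
  have hdis : Equiv.Perm.Disjoint (Equiv.swap a b) γ := by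
    intro x
    by_cases hx : x ∈ ({a, b}ᶜ : Finset (Fin n))
    · left
      simp at hx
      exact Equiv.swap_apply_of_ne_of_ne (by tauto) (by tauto)
    · exact Or.inr (hfix x hx)
  have hcard : Multiset.card γ.cycleType = 1 := by
    have := (mem_cyc.1 hγ).2
    rw [numCycles_eq, hsupp, hS] at this
    omega
  obtain ⟨m, hm⟩ := Multiset.card_eq_one.1 hcard
  have hsum := γ.sum_cycleType
  rw [hm, hsupp, hS, Multiset.sum_singleton] at hsum
  rw [hdis.cycleType_mul, hm, hsum, (Equiv.Perm.isSwap_iff_cycleType.1 ⟨a, b, hab, rfl⟩)]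
  rfl

theorem card_two_cycle (hn : 6 ≤ n) {α : Equiv.Perm (Fin n)} (hα : α.cycleType = {2, n - 2}) :
    (Finset.univ.filter fun a => α a ≠ a ∧ α (α a) = a).card = 2 := by
  obtain ⟨c, τ, rfl, hd, hc, hc2⟩ := Equiv.Perm.mem_cycleType_iff.1
    (show 2 ∈ α.cycleType by rw [hα]; simp)
  obtain ⟨x, y, hxy, rfl⟩ := Equiv.Perm.card_support_eq_two.1 hc2
  have hτ : τ.cycleType = {n - 2} := by
    rw [hd.cycleType_mul, hc.cycleType, hc2] at hα
    exact Multiset.cons_inj_right 2 |>.1 hα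
  have hτc : τ.IsCycle := by rw [← Equiv.Perm.card_cycleType_eq_one, hτ]; rfl
  have hord : orderOf τ = n - 2 := by rw [← Equiv.Perm.lcm_cycleType, hτ]; simp
  have hx : τ x = x := (hd x).resolve_left (by simp [hxy.symm])
  have hy : τ y = y := (hd y).resolve_left (by simp [hxy])
  rw [← Finset.card_pair hxy]
  congr 1
  ext a
  rw [Finset.mem_filter, Finset.mem_insert, Finset.mem_singleton, Equiv.Perm.mul_apply,
    Equiv.Perm.mul_apply]
  constructor
  · rintro ⟨-, h1, h2⟩
    by_contra hne
    push Not at hne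
    rcases hd a with h | h
    · have hτx : ∀ z, z ≠ x → z ≠ y → Equiv.swap x y (τ z) = τ z := by
        intro z hzx hzy
        refine Equiv.swap_apply_of_ne_of_ne ?_ ?_
        · intro h; exact hzx (τ.injective (h.trans hx.symm))
        · intro h; exact hzy (τ.injective (h.trans hy.symm))
      have ha := hτx a hne.1 hne.2
      rw [ha] at h1 h2
      rw [hτx (τ a) (fun h => hne.1 (τ.injective (h.trans hx.symm)))
        (fun h => hne.2 (τ.injective (h.trans hy.symm)))] at h2
      have h3 : τ ^ 2 = 1 := hτc.pow_eq_one_iff.2 ⟨a, h1, by rw [pow_two]; exact h2⟩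
      have := Nat.le_of_dvd (by norm_num) (orderOf_dvd_of_pow_eq_one h3)
      omega
    · rw [h] at h1
      exact h1 (Equiv.swap_apply_of_ne_of_ne hne.1 hne.2)
  · rintro (rfl | rfl)
    · simp [hx, hy, hxy.symm]
    · simp [hx, hy, hxy]

/-- Each permutation of cycle type `[2, n - 2]` arises from the two orderings of its two-cycle. -/
theorem sum_pairs_cyc (hn : 6 ≤ n) (f : Equiv.Perm (Fin n) → ℂ) :
    ∑ a : Fin n, ∑ b ∈ Finset.univ.erase a, ∑ γ ∈ cyc ({a, b}ᶜ : Finset (Fin n)),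
      f (Equiv.swap a b * γ) =
    2 * ∑ α ∈ Finset.univ.filter (fun α : Equiv.Perm (Fin n) => fullCycleType α = {2, n - 2}),
      f α := by
  have key : ∀ a : Fin n, ∑ b ∈ Finset.univ.erase a, ∑ γ ∈ cyc ({a, b}ᶜ : Finset (Fin n)),
      f (Equiv.swap a b * γ) =
      ∑ α ∈ (Finset.univ.filter fun α : Equiv.Perm (Fin n) => fullCycleType α = {2, n - 2}) with
        α a ≠ a ∧ α (α a) = a, f α := by
    intro a
    rw [Finset.sum_sigma']
    refine Finset.sum_nbij' (fun p => Equiv.swap a p.1 * p.2)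
      (fun α => ⟨α a, Equiv.swap a (α a) * α⟩) ?_ ?_ ?_ ?_ ?_
    · rintro ⟨b, γ⟩ h
      obtain ⟨hb, hγ⟩ := Finset.mem_sigma.1 h
      dsimp only at hb hγ ⊢
      have hab : a ≠ b := (Finset.ne_of_mem_erase hb).symm
      have ha : γ a = a := (mem_cyc.1 hγ).1 a (by simp)
      have hb' : γ b = b := (mem_cyc.1 hγ).1 b (by simp)
      simp only [Finset.mem_filter, Finset.mem_univ, true_and]
      refine ⟨(fullCycleType_eq_two_iff hn _).2 (cycleType_swap_mul_of_mem_cyc hn hab hγ), ?_, ?_⟩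
      · simp [ha, hab.symm]
      · simp [ha, hb']
    · intro α h
      simp only [Finset.mem_filter, Finset.mem_univ, true_and] at h
      obtain ⟨h, hne, hαα⟩ := h
      refine Finset.mem_sigma.2 ⟨by simp [hne], ?_⟩
      dsimp only
      refine mem_cyc.2 ⟨fun x hx => ?_, ?_⟩
      · simp only [Finset.mem_compl, not_not, Finset.mem_insert, Finset.mem_singleton] at hx
        rcases hx with rfl | rfl
        · simp
        · simp [hαα]
      · rw [numCycles_swap_mul α a hne, numCycles, h, card_pair_compl hne.symm]
        simp
        omega
    · rintro ⟨b, γ⟩ h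
      obtain ⟨hb, hγ⟩ := Finset.mem_sigma.1 h
      have ha : γ a = a := (mem_cyc.1 hγ).1 a (by simp)
      simp [ha, ← mul_assoc]
    · intro α h
      simp [← mul_assoc]
    · intro p hp
      rfl
  rw [Finset.sum_congr rfl fun a _ => key a]
  simp only [Finset.sum_filter (p := fun α : Equiv.Perm (Fin n) => α _ ≠ _ ∧ _)]
  rw [Finset.sum_comm, Finset.mul_sum]
  refine Finset.sum_congr rfl fun α hα => ?_
  have hα' := (fullCycleType_eq_two_iff hn _).1 (Finset.mem_filter.1 hα).2
  rw [← Finset.sum_filter, Finset.sum_const, card_two_cycle hn hα']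
  simp

end Class

section Pairs

variable {n : ℕ}

/-- The generating series in `q` of `∑ q ^ κ((a b) γ ω)` over the cycles `γ` avoiding `a`, `b`. -/
noncomputable def pairSeries (ω : Equiv.Perm (Fin n)) (a b : Fin n) : PowerSeries ℂ :=
  PowerSeries.mk fun q => ∑ γ ∈ cyc ({a, b}ᶜ : Finset (Fin n)),
    (q : ℂ) ^ numCycles (Equiv.swap a b * γ * ω)

theorem pairSeries_comm (ω : Equiv.Perm (Fin n)) (a b : Fin n) :
    pairSeries ω a b = pairSeries ω b a := by
  rw [pairSeries, pairSeries, Finset.pair_comm, Equiv.swap_comm]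

theorem numCycles_delete {γ κ : Equiv.Perm (Fin n)} {a : Fin n} (hγ : γ a = a) (hκ : κ a ≠ a) :
    numCycles (γ * (Equiv.swap a (κ a) * κ)) = numCycles (γ * κ) + 1 := by
  have h : (γ * κ) a ≠ a := fun h => hκ (γ.injective (h.trans hγ.symm))
  rw [← numCycles_swap_mul (γ * κ) a h, Equiv.Perm.mul_apply, ← mul_assoc, ← mul_assoc,
    Equiv.mul_swap_eq_swap_mul, hγ]

theorem numCycles_swap_mul_mul (γ ω : Equiv.Perm (Fin n)) (a b : Fin n) :
    numCycles (Equiv.swap a b * γ * ω) = numCycles (γ * (ω * Equiv.swap a b)) := by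
  rw [mul_assoc, numCycles_mul_comm, mul_assoc]

theorem sq_X_mul_pairSeries_of_nonadjacent {ω : Equiv.Perm (Fin n)}
    {R : Matrix (Fin n) (Fin n) (PowerSeries ℂ)}
    (hR : cycleMatrix (fun _ => PowerSeries.X) ω * R = 1) (hn : 3 ≤ n) {a b : Fin n} (hab : a ≠ b)
    (h1 : ω a ≠ b) (h2 : ω b ≠ a) (h3 : ω a = a → ω b ≠ b) :
    PowerSeries.X ^ 2 * pairSeries ω a b =
      ((n - 3).factorial : PowerSeries ℂ) * PowerSeries.X * geomSer ^ n *
      (cycleDet PowerSeries.X ω *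
        (PowerSeries.X ^ 2 * (R a a * R b b - R a b * R b a) + R a b * R b a -
          (R a a - 1) * (R b b - 1) - PowerSeries.X * (R a b + R b a))) := by
  set κ := ω * Equiv.swap a b with hκ
  have hκa : κ a = ω b := by simp [hκ]
  have hκb : κ b = ω a := by simp [hκ]
  have hκa' : κ a ≠ a := by rwa [hκa]
  set κ' := Equiv.swap a (κ a) * κ with hκ'
  have hκ'a : κ' a = a := by simp [hκ']
  have hκ'b : κ' b ≠ b := by
    rw [hκ', Equiv.Perm.mul_apply, hκb, hκa]
    by_cases h : ω a = a
    · rw [h, Equiv.swap_apply_left]; exact h3 h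
    · rw [Equiv.swap_apply_of_ne_of_ne h (fun h => hab (ω.injective h))]; exact h1
  set ρ := Equiv.swap b (κ' b) * κ' with hρ
  have hρb : ρ b = b := by simp [hρ]
  have hρa : ρ a = a := by
    rw [hρ, Equiv.Perm.mul_apply, hκ'a, Equiv.swap_apply_of_ne_of_ne hab]
    intro h; exact hab (κ'.injective (hκ'a.trans h))
  have hS := card_pair_compl hab
  have hseries : pairSeries ω a b = cycSeries ({a, b}ᶜ : Finset (Fin n)) ρ := by
    rw [pairSeries, cycSeries]
    congr 1
    ext q
    refine Finset.sum_congr rfl fun γ hγ => ?_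
    have hγa : γ a = a := (mem_cyc.1 hγ).1 a (by simp)
    have hγb : γ b = b := (mem_cyc.1 hγ).1 b (by simp)
    rw [numCycles_swap_mul_mul, ← hκ, hS, hρ, numCycles_delete hγb hκ'b, hκ',
      numCycles_delete hγa hκa']
    congr 1
    omega
  have hne : ({a, b}ᶜ : Finset (Fin n)).Nonempty := by rw [← Finset.card_pos, hS]; omega
  rw [hseries, cycSeries_eq hne (by
    intro x hx
    simp only [Finset.mem_compl, not_not, Finset.mem_insert, Finset.mem_singleton] at hx
    rcases hx with rfl | rfl <;> assumption), hS, Nat.sub_sub]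
  have hdet : cycleDet PowerSeries.X ρ = (1 - PowerSeries.X : PowerSeries ℂ) ^ 2 *
      (cycleMatrix (Function.update (Function.update (fun _ => PowerSeries.X) a 1) b 1) κ).det := by
    have e1 := det_cycleMatrix_delete (fun _ => (PowerSeries.X : PowerSeries ℂ)) κ' b hκ'b
      PowerSeries.X
    have e2 := det_cycleMatrix_delete
      (Function.update (fun _ => (PowerSeries.X : PowerSeries ℂ)) b 1) κ a hκa' PowerSeries.X
    rw [Function.update_eq_self_iff.2 rfl, ← hρ] at e1
    rw [Function.update_eq_self_iff.2 (Function.update_of_ne hab _ _).symm, ← hκ',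
      Function.update_comm hab.symm] at e2
    rw [cycleDet, e1, e2]
    ring
  have hmain := det_delete_both hR hab
  rw [← hκ] at hmain
  have hI : (1 - PowerSeries.X : PowerSeries ℂ) ^ 2 * geomSer ^ 2 = 1 := by
    rw [← mul_pow, one_sub_mul_geomSer, one_pow]
  rw [← hmain, hdet]
  linear_combination (((n - 3).factorial : PowerSeries ℂ) * PowerSeries.X ^ 3 * geomSer ^ n *
    (cycleMatrix (Function.update (Function.update (fun _ => PowerSeries.X) a 1) b 1) κ).det) * hI

theorem exists_pairSeries_of_adjacent {ω : Equiv.Perm (Fin n)}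
    {R : Matrix (Fin n) (Fin n) (PowerSeries ℂ)}
    (hR : cycleMatrix (fun _ => PowerSeries.X) ω * R = 1) (hn : 3 ≤ n) {a : Fin n} (ha : a ≠ ω a)
    (h2 : ω (ω a) ≠ a) :
    ∃ c : PowerSeries ℂ, pairSeries ω a (ω a) = PowerSeries.X * serD c ∧
      PowerSeries.X ^ 2 * c = ((n - 3).factorial : PowerSeries ℂ) * PowerSeries.X * geomSer ^ n *
        (cycleDet PowerSeries.X ω * (PowerSeries.X ^ 2 * R a a - (R a a - 1))) := by
  set b := ω a with hb
  set κ := ω * Equiv.swap a b with hκ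
  have hκa : κ a = ω b := by simp [hκ]
  have hκb : κ b = b := by simp [hκ, hb]
  have hκa' : κ a ≠ a := by rwa [hκa]
  set κ' := Equiv.swap a (κ a) * κ with hκ'
  have hκ'a : κ' a = a := by simp [hκ']
  have hκ'b : κ' b = b := by
    rw [hκ', Equiv.Perm.mul_apply, hκb, hκa, Equiv.swap_apply_of_ne_of_ne ha.symm]
    intro h; exact ha (ω.injective h)
  have hS := card_pair_compl ha
  have hne : ({a, b}ᶜ : Finset (Fin n)).Nonempty := by rw [← Finset.card_pos, hS]; omega
  refine ⟨cycSeries ({a, b}ᶜ : Finset (Fin n)) κ', ?_, ?_⟩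
  · rw [cycSeries, X_mul_serD_mk, pairSeries]
    congr 1
    ext q
    rw [Finset.mul_sum]
    refine Finset.sum_congr rfl fun γ hγ => ?_
    have hγa : γ a = a := (mem_cyc.1 hγ).1 a (by simp)
    have hγb : γ b = b := (mem_cyc.1 hγ).1 b (by simp)
    have hlt := card_lt_numCycles (γ * κ') {a, b} (by
      intro x hx
      simp only [Finset.mem_insert, Finset.mem_singleton] at hx
      rcases hx with rfl | rfl
      · rw [Equiv.Perm.mul_apply, hκ'a, hγa]
      · rw [Equiv.Perm.mul_apply, hκ'b, hγb]) (by
      intro h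
      rw [← Finset.compl_eq_empty_iff] at h
      exact hne.ne_empty h)
    rw [Finset.card_pair ha] at hlt
    rw [hκ', numCycles_delete hγa hκa'] at hlt
    rw [numCycles_swap_mul_mul, ← hκ, hS, hκ', numCycles_delete hγa hκa', ← pow_succ']
    congr 1
    omega
  · rw [cycSeries_eq hne (by
      intro x hx
      simp only [Finset.mem_compl, not_not, Finset.mem_insert, Finset.mem_singleton] at hx
      rcases hx with rfl | rfl <;> assumption), hS, Nat.sub_sub]
    have hdet : cycleDet PowerSeries.X κ' = (1 - PowerSeries.X : PowerSeries ℂ) *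
        (cycleMatrix (Function.update (fun _ => PowerSeries.X) a 1) κ).det := by
      have e1 := det_cycleMatrix_delete (fun _ => (PowerSeries.X : PowerSeries ℂ)) κ a hκa'
        PowerSeries.X
      rwa [Function.update_eq_self_iff.2 rfl, ← hκ'] at e1
    have hmain := det_delete_adjacent hR ha
    rw [← hb, ← hκ] at hmain
    have hI : (1 - PowerSeries.X : PowerSeries ℂ) ^ 2 * geomSer ^ 2 = 1 := by
      rw [← mul_pow, one_sub_mul_geomSer, one_pow]
    rw [hdet]
    linear_combination (((n - 3).factorial : PowerSeries ℂ) * PowerSeries.X * geomSer ^ (n + 2) *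
      (1 - PowerSeries.X)) * hmain + (((n - 3).factorial : PowerSeries ℂ) * PowerSeries.X *
      geomSer ^ n * (cycleDet PowerSeries.X ω * (PowerSeries.X ^ 2 * R a a - (R a a - 1)))) * hI

theorem sum_pairSeries {ω : Equiv.Perm (Fin n)} (hn : 3 ≤ n) (h2 : ∀ a, ω a ≠ a → ω (ω a) ≠ a)
    (hfix : ∀ a b, ω a = a → ω b = b → a = b) :
    ∑ a : Fin n, ∑ b ∈ Finset.univ.erase a, pairSeries ω a b =
      ((n - 3).factorial : PowerSeries ℂ) * PowerSeries.X *
        ((1 + PowerSeries.X) * serD (serD (cycleDet PowerSeries.X ω * geomSer ^ (n - 1))) +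
          2 * ((Finset.univ.filter fun a => ω a = a).card : PowerSeries ℂ) *
            serD (cycleDet PowerSeries.X ω * geomSer ^ n)) := by
  have hI := one_sub_mul_geomSer
  obtain ⟨R, hR⟩ := exists_resolvent ω
  set G : PowerSeries ℂ := cycleDet PowerSeries.X ω with hG
  set k : ℕ := (Finset.univ.filter fun a => ω a = a).card with hk
  set f : PowerSeries ℂ := ((n - 3).factorial : PowerSeries ℂ) with hf
  let E : Fin n → Fin n → PowerSeries ℂ := fun a b =>
    PowerSeries.X ^ 2 * (R a a * R b b - R a b * R b a) + R a b * R b a -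
      (R a a - 1) * (R b b - 1) - PowerSeries.X * (R a b + R b a)
  have hadj : ∀ a, ∃ c : PowerSeries ℂ, ω a ≠ a →
      pairSeries ω a (ω a) = PowerSeries.X * serD c ∧
      PowerSeries.X ^ 2 * c = f * PowerSeries.X * geomSer ^ n *
        (G * (PowerSeries.X ^ 2 * R a a - (R a a - 1))) := by
    intro a
    by_cases ha : ω a = a
    · exact ⟨0, fun h => (h ha).elim⟩
    · obtain ⟨c, hc⟩ := exists_pairSeries_of_adjacent hR hn (Ne.symm ha) (h2 a ha)
      exact ⟨c, fun _ => hc⟩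
  choose c hc using hadj
  have hpair : ∀ a, ∀ b ∈ Finset.univ.erase a, PowerSeries.X ^ 2 * pairSeries ω a b =
      f * PowerSeries.X * geomSer ^ n * (G * E a b) +
      ((if b = ω a then PowerSeries.X ^ 2 * (PowerSeries.X * serD (c a)) else 0) +
       (if a = ω b then PowerSeries.X ^ 2 * (PowerSeries.X * serD (c b)) else 0)) := by
    intro a b hb
    have hab : a ≠ b := (Finset.ne_of_mem_erase hb).symm
    by_cases hba : b = ω a
    · have hE : E a b = 0 := by
        have := delete_both_factor_adjacent hR (a := a) (by rwa [← hba])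
        rw [← hba] at this; exact this
      have hne : a ≠ ω b := by rw [hba]; exact (h2 a (by rw [← hba]; exact hab.symm)).symm
      rw [hE, if_pos hba, if_neg hne, hba, (hc a (by rw [← hba]; exact hab.symm)).1]
      ring
    by_cases hab' : a = ω b
    · have hE : E a b = 0 := by
        have := delete_both_factor_adjacent hR (a := b) (by rw [← hab']; exact hab.symm)
        rw [← hab'] at this
        simp only [E]
        linear_combination this
      rw [hE, if_neg hba, if_pos hab', pairSeries_comm, hab',
        (hc b (by rw [← hab']; exact hab)).1]
      ring
    rw [if_neg hba, if_neg hab', sq_X_mul_pairSeries_of_nonadjacent hR hn hab (Ne.symm hba)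
      (Ne.symm hab') (fun h h' => hab (hfix a b h h'))]
    simp only [E]
    ring
  have hX2 : (PowerSeries.X ^ 2 : PowerSeries ℂ) ≠ 0 := pow_ne_zero _ PowerSeries.X_ne_zero
  set T1 := R.trace with hT1
  set T2 := (R * R).trace with hT2
  set C : PowerSeries ℂ := ∑ a ∈ Finset.univ.filter fun a => ω a ≠ a, c a with hC
  have hsumE : ∑ a, ∑ b ∈ Finset.univ.erase a, E a b =
      PowerSeries.X ^ 2 * (T1 ^ 2 - T2) + T2 - (T1 - (n : PowerSeries ℂ)) ^ 2 -
        2 * PowerSeries.X * (n : PowerSeries ℂ) * geomSer -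
        (2 * T1 - (n : PowerSeries ℂ) - 2 * PowerSeries.X * T1) := by
    have e1 : ∀ a, ∑ b ∈ Finset.univ.erase a, E a b =
        ∑ b, E a b - (2 * R a a - 1 - 2 * PowerSeries.X * R a a) := by
      intro a
      rw [← Finset.add_sum_erase _ _ (Finset.mem_univ a)]
      simp only [E]
      ring
    have e2 : ∑ a, ∑ b, R a b * R b a = T2 := by
      simp [hT2, Matrix.trace, Matrix.mul_apply]
    have e3 : ∑ a, R a a = T1 := rfl
    have e4 : ∑ a, ∑ b, R a b = (n : PowerSeries ℂ) * geomSer := by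
      rw [Finset.sum_congr rfl fun a _ => resolvent_row_sum hI hR a]; simp
    have e5 : ∑ a, ∑ b, R b a = (n : PowerSeries ℂ) * geomSer := by
      rw [Finset.sum_congr rfl fun a _ => resolvent_col_sum hI hR a]; simp
    rw [Finset.sum_congr rfl fun a _ => e1 a]
    simp only [E, Finset.sum_sub_distrib, Finset.sum_add_distrib, ← Finset.mul_sum, mul_sub,
      mul_add, ← Finset.sum_mul, e2, e3, e4, e5]
    simp only [Finset.mul_sum]
    simp only [mul_one, Finset.sum_const, Finset.card_univ, Fintype.card_fin, nsmul_eq_mul]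
    ring
  have htotal : PowerSeries.X ^ 2 * ∑ a, ∑ b ∈ Finset.univ.erase a, pairSeries ω a b =
      f * PowerSeries.X * geomSer ^ n * (G * ∑ a, ∑ b ∈ Finset.univ.erase a, E a b) +
        2 * (PowerSeries.X ^ 2 * (PowerSeries.X * serD C)) := by
    have e1 : ∑ a, ∑ b ∈ Finset.univ.erase a,
        (if b = ω a then PowerSeries.X ^ 2 * (PowerSeries.X * serD (c a)) else 0) =
        PowerSeries.X ^ 2 * (PowerSeries.X * serD C) := by
      rw [hC, map_sum, Finset.mul_sum, Finset.mul_sum, Finset.sum_filter]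
      refine Finset.sum_congr rfl fun a _ => ?_
      rw [Finset.sum_ite_eq']
      simp
    have e2 : ∑ a, ∑ b ∈ Finset.univ.erase a,
        (if a = ω b then PowerSeries.X ^ 2 * (PowerSeries.X * serD (c b)) else 0) =
        PowerSeries.X ^ 2 * (PowerSeries.X * serD C) := by
      rw [← e1]
      rw [Finset.sum_comm' (t' := Finset.univ) (s' := fun b => Finset.univ.erase b)]
      simp [eq_comm]
    rw [Finset.mul_sum]
    simp only [Finset.mul_sum (s := Finset.univ.erase _)]
    rw [Finset.sum_congr rfl fun a _ => Finset.sum_congr rfl (hpair a)]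
    simp only [Finset.sum_add_distrib, e1, e2, Finset.mul_sum]
    ring
  have hGT := derivation_cycleDet serD serD_X hR
  have hDT := derivation_trace_resolvent serD serD_X hR
  rw [← hG, ← hT1] at hGT
  rw [← hT1, ← hT2] at hDT
  have hD2 := congrArg serD hGT
  simp only [Derivation.leibniz, map_sub, Derivation.map_natCast, serD_X, smul_eq_mul] at hD2
  set G1 := serD G with hG1
  set G2 := serD G1 with hG2
  have hCsum : PowerSeries.X ^ 2 * C = PowerSeries.X ^ 2 * (f * geomSer ^ n *
      ((n : PowerSeries ℂ) * PowerSeries.X * G + (1 - PowerSeries.X ^ 2) * G1 +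
        (k : PowerSeries ℂ) * G)) := by
    have e0 : ∑ a ∈ Finset.univ.filter (fun a => ω a ≠ a), R a a =
        T1 - (k : PowerSeries ℂ) * geomSer := by
      rw [hT1, Matrix.trace, ← Finset.sum_filter_add_sum_filter_not Finset.univ (fun a => ω a = a)]
      have : ∀ a ∈ Finset.univ.filter (fun a => ω a = a), R.diag a = geomSer := by
        intro a ha
        rw [Matrix.diag_apply, resolvent_fixed hI hR (Finset.mem_filter.1 ha).2, if_pos rfl]
      rw [Finset.sum_congr rfl this, Finset.sum_const, nsmul_eq_mul]
      simp [Matrix.diag_apply, hk]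
    have e1 : (((Finset.univ.filter fun a => ω a ≠ a).card : ℕ) : PowerSeries ℂ) =
        (n : PowerSeries ℂ) - k := by
      have := Finset.card_filter_add_card_filter_not (s := Finset.univ) (fun a => ω a = a)
      rw [Finset.card_univ, Fintype.card_fin] at this
      have := congrArg (Nat.cast (R := PowerSeries ℂ)) this
      push_cast at this
      rw [eq_sub_iff_add_eq, hk, add_comm]
      exact this
    have e2 : PowerSeries.X ^ 2 * C = f * PowerSeries.X * geomSer ^ n *
        (G * (PowerSeries.X ^ 2 * (T1 - (k : PowerSeries ℂ) * geomSer) -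
          (T1 - (k : PowerSeries ℂ) * geomSer - ((n : PowerSeries ℂ) - (k : PowerSeries ℂ))))) := by
      rw [hC, Finset.mul_sum,
        Finset.sum_congr rfl fun a ha => (hc a (Finset.mem_filter.1 ha).2).2,
        ← Finset.mul_sum, ← Finset.mul_sum, Finset.sum_sub_distrib, Finset.sum_sub_distrib,
        ← Finset.mul_sum, e0, Finset.sum_const, nsmul_eq_mul, mul_one, e1]
    rw [e2]
    linear_combination (f * PowerSeries.X * geomSer ^ n * (1 - PowerSeries.X ^ 2)) * (-hGT) +
      (f * PowerSeries.X * geomSer ^ n * G * (k : PowerSeries ℂ) * (1 + PowerSeries.X)) * hI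
  have hCval := mul_left_cancel₀ hX2 hCsum
  have hGT2 : G * T2 = G * T1 + ((n : PowerSeries ℂ) - T1) * (PowerSeries.X * G1) -
      PowerSeries.X * G1 - PowerSeries.X ^ 2 * G2 := by
    linear_combination PowerSeries.X * hD2 - G * hDT
  have key : G * (PowerSeries.X ^ 2 * (T1 ^ 2 - T2) + T2 - (T1 - (n : PowerSeries ℂ)) ^ 2 -
        2 * PowerSeries.X * (n : PowerSeries ℂ) * geomSer -
        (2 * T1 - (n : PowerSeries ℂ) - 2 * PowerSeries.X * T1)) =
      PowerSeries.X ^ 2 * (((n : PowerSeries ℂ) ^ 2 - (n : PowerSeries ℂ)) * G -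
        (2 * (n : PowerSeries ℂ) - 2) * PowerSeries.X * G1 + (PowerSeries.X ^ 2 - 1) * G2 -
        2 * (n : PowerSeries ℂ) * geomSer * G - 2 * G1) := by
    linear_combination (1 - PowerSeries.X ^ 2) * hGT2 +
      ((1 - PowerSeries.X ^ 2) * ((n : PowerSeries ℂ) - T1) -
      (1 - PowerSeries.X ^ 2) + (2 * (n : PowerSeries ℂ) - 2) * PowerSeries.X ^ 2 +
      2 * PowerSeries.X) * hGT - (2 * PowerSeries.X * (n : PowerSeries ℂ) * G) * hI
  apply mul_left_cancel₀ hX2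
  rw [htotal, hsumE, key, hCval]
  clear_value f G1 G2 G k T1 T2
  obtain ⟨m, rfl⟩ : ∃ m, n = m + 3 := ⟨n - 3, by omega⟩
  have hm1 : m + 3 - 1 = m + 2 := rfl
  have hm2 : m + 2 - 1 = m + 1 := rfl
  have hm3 : m + 1 - 1 = m := rfl
  have hfD : serD f = 0 := by rw [hf, Derivation.map_natCast]
  simp only [Derivation.leibniz, Derivation.leibniz_pow, Derivation.map_natCast, serD_X, map_add,
    map_sub, serD_geomSer, smul_eq_mul, nsmul_eq_mul, hm1, hm2, hm3, ← hG1, ← hG2,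
    Derivation.map_one_eq_zero, hfD]
  push_cast
  linear_combination (PowerSeries.X ^ 2 * f * PowerSeries.X * geomSer ^ (m + 2) *
    ((1 + PowerSeries.X) * G2 + 2 * ((m : PowerSeries ℂ) + 3) * (1 + PowerSeries.X) * geomSer * G1 -
      (((m : PowerSeries ℂ) + 3) ^ 2 + ((m : PowerSeries ℂ) + 3)) * geomSer * G)) * hI

end Pairs

section CycleDet

variable {A : Type*} [CommRing A] {n : ℕ}

theorem eq_one_or_eq_of_isCycle {σ τ : Equiv.Perm (Fin n)} (hσ : σ.IsCycle)
    (h : ∀ i, τ i = i ∨ τ i = σ i) : τ = 1 ∨ τ = σ := by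
  by_contra! hne
  obtain ⟨a, ha⟩ : ∃ a, τ a ≠ a := by
    by_contra! h'
    exact hne.1 (Equiv.ext h')
  have haσ : τ a = σ a := (h a).resolve_left ha
  have hk : ∀ k : ℕ, τ ((σ ^ k) a) = σ ((σ ^ k) a) := by
    intro k
    induction k with
    | zero => exact haσ
    | succ k ih =>
      rw [pow_succ', Equiv.Perm.mul_apply]
      refine (h _).resolve_left fun hfix => ?_
      have := τ.injective (hfix.trans ih.symm)
      rw [← Equiv.Perm.mul_apply, ← pow_succ', pow_succ, Equiv.Perm.mul_apply] at this
      exact ha (haσ.trans ((σ ^ k).injective this))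
  refine hne.2 (Equiv.ext fun x => ?_)
  by_cases hx : σ x = x
  · rcases h x with h' | h'
    · rw [h', hx]
    · exact h'
  · obtain ⟨k, rfl⟩ := hσ.exists_pow_eq (haσ ▸ ha) hx
    exact hk k

theorem cycleDet_of_isCycle (t : A) {σ : Equiv.Perm (Fin n)} (hσ : σ.IsCycle) :
    cycleDet t σ = (1 - t ^ σ.support.card) * (1 - t) ^ (n - σ.support.card) := by
  have hcard : (σ.supportᶜ).card = n - σ.support.card := by
    rw [Finset.card_compl, Fintype.card_fin]
  rw [cycleDet, Matrix.det_apply', Finset.sum_eq_add 1 σ hσ.ne_one.symm]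
  · have e1 : ∏ i, cycleMatrix (fun _ => t) σ ((1 : Equiv.Perm (Fin n)) i) i =
        (1 - t) ^ (n - σ.support.card) := by
      rw [← Finset.prod_compl_mul_prod σ.support, Finset.prod_congr rfl (g := fun _ => 1 - t),
        Finset.prod_congr (s₁ := σ.support) rfl (g := fun _ => 1)]
      · simp [hcard]
      · intro i hi
        simp [cycleMatrix_apply, Equiv.Perm.mem_support.1 hi]
      · intro i hi
        have : σ i = i := by simpa using hi
        simp [cycleMatrix_apply, this]
    have e2 : ∏ i, cycleMatrix (fun _ => t) σ (σ i) i =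
        (1 - t) ^ (n - σ.support.card) * (-t) ^ σ.support.card := by
      rw [← Finset.prod_compl_mul_prod σ.support, Finset.prod_congr rfl (g := fun _ => 1 - t),
        Finset.prod_congr (s₁ := σ.support) rfl (g := fun _ => -t)]
      · simp [hcard]
      · intro i hi
        simp [cycleMatrix_apply, Equiv.Perm.mem_support.1 hi]
      · intro i hi
        have : σ i = i := by simpa using hi
        simp [cycleMatrix_apply, this]
    rw [e1, e2, hσ.sign, neg_pow t]
    have : ((-1 : A) ^ σ.support.card) * (-1) ^ σ.support.card = 1 := by
      rw [← mul_pow]; simp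
    push_cast
    simp only [Equiv.Perm.sign_one, Units.val_one, Int.cast_one]
    linear_combination (-(1 - t) ^ (n - σ.support.card) * t ^ σ.support.card) * this
  · intro τ _ hτ
    obtain ⟨i, hi⟩ : ∃ i, ¬ (τ i = i ∨ τ i = σ i) := by
      by_contra! h'
      rcases eq_one_or_eq_of_isCycle hσ h' with h1 | h1
      · exact hτ.1 h1
      · exact hτ.2 h1
    push Not at hi
    rw [Finset.prod_eq_zero (Finset.mem_univ i), mul_zero]
    simp [cycleMatrix_apply, hi.1, Ne.symm hi.2]
  · simp
  · simp

theorem cycleDet_mul_of_disjoint (t : A) {σ τ : Equiv.Perm (Fin n)} (h : σ.Disjoint τ) :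
    cycleDet t σ * cycleDet t τ = (1 - t) ^ n * cycleDet t (σ * τ) := by
  have : cycleMatrix (fun _ => t) σ * cycleMatrix (fun _ => t) τ =
      (1 - t) • cycleMatrix (fun _ => t) (σ * τ) := by
    ext i j
    simp only [Matrix.mul_apply, cycleMatrix_apply, Matrix.smul_apply, smul_eq_mul, sub_mul,
      mul_sub, Finset.sum_sub_distrib, ite_mul, mul_ite, zero_mul, mul_zero, one_mul, mul_one,
      Finset.sum_ite_eq, Finset.sum_ite_eq', Finset.mem_univ, if_true, Equiv.Perm.mul_apply]
    rcases h j with hj | hj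
    · have : σ (τ j) = τ j := by
        rcases h (τ j) with h' | h'
        · exact h'
        · rw [τ.injective h', hj]
      simp [this, hj]
      simp only [eq_comm (a := i)]
      split_ifs <;> ring
    · simp [hj]
      simp only [eq_comm (a := i)]
      split_ifs <;> ring
  rw [cycleDet, cycleDet, ← Matrix.det_mul, this, Matrix.det_smul, Fintype.card_fin]
  rfl

theorem cycleDet_X_eq (σ : Equiv.Perm (Fin n)) :
    cycleDet (PowerSeries.X : PowerSeries ℂ) σ =
      ((fullCycleType σ).map fun b => 1 - PowerSeries.X ^ b).prod := by
  suffices h : cycleDet (PowerSeries.X : PowerSeries ℂ) σ =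
      (σ.cycleType.map fun b => 1 - PowerSeries.X ^ b).prod *
        (1 - PowerSeries.X) ^ (n - σ.cycleType.sum) by
    simp [h, fullCycleType]
  have hne : (1 - PowerSeries.X : PowerSeries ℂ) ≠ 0 :=
    left_ne_zero_of_mul_eq_one one_sub_mul_geomSer
  induction σ using Equiv.Perm.cycle_induction_on with
  | base_one => simp [cycleDet_one]
  | base_cycles σ hσ =>
    rw [cycleDet_of_isCycle _ hσ, hσ.cycleType]
    simp
  | induction_disjoint σ τ hd hσ h1 h2 =>
    apply mul_left_cancel₀ (pow_ne_zero n hne)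
    have hle : σ.cycleType.sum + τ.cycleType.sum ≤ n := by
      rw [← Multiset.sum_add, ← hd.cycleType_mul, Equiv.Perm.sum_cycleType]
      simpa using Finset.card_le_univ (σ * τ).support
    rw [← cycleDet_mul_of_disjoint _ hd, h1, h2, hd.cycleType_mul, Multiset.map_add,
      Multiset.prod_add, Multiset.sum_add]
    have : (1 - PowerSeries.X : PowerSeries ℂ) ^ (n - σ.cycleType.sum) *
        (1 - PowerSeries.X) ^ (n - τ.cycleType.sum) = (1 - PowerSeries.X) ^ n *
          (1 - PowerSeries.X) ^ (n - (σ.cycleType.sum + τ.cycleType.sum)) := by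
      rw [← pow_add, ← pow_add]
      congr 1
      omega
    linear_combination (σ.cycleType.map fun b => 1 - PowerSeries.X ^ b).prod *
      (τ.cycleType.map fun b => 1 - PowerSeries.X ^ b).prod * this

end CycleDet

section LogConcave

/-- Nonnegative and totally positive of order two: log-concave without internal zeros. -/
def IsPF2 (a : ℕ → ℝ) : Prop :=
  (∀ k, 0 ≤ a k) ∧ ∀ i j, i ≤ j → a i * a (j + 2) ≤ a (i + 1) * a (j + 1)

theorem IsPF2.mul_linear {a b : ℕ → ℝ} (ha : IsPF2 a) {r : ℝ} (hr : 0 ≤ r) (h0 : b 0 = r * a 0)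
    (hb : ∀ k, b (k + 1) = a k + r * a (k + 1)) : IsPF2 b := by
  obtain ⟨hpos, hlc⟩ := ha
  refine ⟨fun k => ?_, fun i j hij => ?_⟩
  · rcases k with _ | k
    · rw [h0]
      exact mul_nonneg hr (hpos 0)
    · rw [hb]
      exact add_nonneg (hpos k) (mul_nonneg hr (hpos _))
  · rcases i with _ | i
    · rw [h0, hb, hb, hb]
      have h1 := mul_le_mul_of_nonneg_left (hlc 0 j hij) (mul_nonneg hr hr)
      have h2 := mul_nonneg (hpos 0) (hpos j)
      have h3 := mul_nonneg hr (mul_nonneg (hpos (0 + 1)) (hpos j))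
      linarith
    · obtain ⟨j, rfl⟩ : ∃ l, j = l + 1 := ⟨j - 1, by omega⟩
      rw [hb, hb, hb, hb]
      have h1 := mul_le_mul_of_nonneg_left (hlc (i + 1) (j + 1) hij) (mul_nonneg hr hr)
      have h2 := hlc i j (by omega)
      have h3 : a (i + 1) * a (j + 1 + 1) ≤ a (i + 1 + 1) * a (j + 1) := by
        rcases Nat.lt_or_ge i j with h | h
        · exact hlc (i + 1) j h
        · obtain rfl : i = j := by omega
          rw [mul_comm]
      have h4 := mul_le_mul_of_nonneg_left ((hlc i (j + 1) (by omega)).trans h3) hr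
      linarith

theorem IsPF2.unimodal {a : ℕ → ℝ} (ha : IsPF2 a) {N : ℕ} (hN : ∀ k, N ≤ k → a k = 0) :
    ∃ t, (∀ k < t, a k ≤ a (k + 1)) ∧ ∀ k, t ≤ k → a (k + 1) ≤ a k := by
  by_cases h : ∃ k, a (k + 1) < a k
  · refine ⟨Nat.find h, fun k hk => not_lt.1 (Nat.find_min h hk), fun k hk => ?_⟩
    have ht := Nat.find_spec h
    rcases hk.eq_or_lt with hk | hk
    · rw [← hk]
      exact ht.le
    · obtain ⟨j, rfl⟩ : ∃ l, k = l + 1 := ⟨k - 1, by omega⟩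
      exact le_of_mul_le_mul_left ((ha.2 _ j (by omega)).trans
        (mul_le_mul_of_nonneg_right ht.le (ha.1 _))) ((ha.1 _).trans_lt ht)
  · push Not at h
    have hz : ∀ k, a k = 0 := fun k => le_antisymm
      ((monotone_nat_of_le_succ h (le_max_right N k)).trans (hN _ (le_max_left N k)).le) (ha.1 k)
    exact ⟨0, by simp, fun k _ => by rw [hz, hz]⟩

theorem isPF2_coeff_of_roots (P : ℝ[X]) (hlead : 0 ≤ P.leadingCoeff)
    (hroots : ∀ z : ℂ, P ≠ 0 → aeval z P = 0 → z.re = 0) :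
    IsPF2 (fun k => P.coeff (2 * k)) ∧ IsPF2 (fun k => P.coeff (2 * k + 1)) := by
  have hzero : ∀ a : ℕ → ℝ, (∀ k, a (k + 1) = 0) → 0 ≤ a 0 → IsPF2 a := by
    intro a ha h0
    refine ⟨fun k => ?_, fun i j _ => by simp [ha]⟩
    rcases k with _ | k
    · exact h0
    · rw [ha]
  induction hd : P.natDegree using Nat.strong_induction_on generalizing P with
  | _ d ih =>
    by_cases hd0 : P.natDegree = 0
    · obtain ⟨c, rfl⟩ := natDegree_eq_zero.1 hd0
      rw [leadingCoeff_C] at hlead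
      refine ⟨hzero _ (fun k => ?_) ?_, hzero _ (fun k => ?_) ?_⟩
      · exact coeff_C_of_ne_zero (by omega)
      · simpa using hlead
      · exact coeff_C_of_ne_zero (by omega)
      · exact (coeff_C_of_ne_zero (by omega)).ge
    · have hP0 : P ≠ 0 := by
        rintro rfl
        simp at hd0
      obtain ⟨z, hz⟩ := IsAlgClosed.exists_aeval_eq_zero ℂ P
        (fun h => hd0 (natDegree_eq_of_degree_eq_some h))
      have hre := hroots z hP0 hz
      by_cases him : z.im = 0
      · have hz0 : z = 0 := Complex.ext hre him
        obtain ⟨Q, rfl⟩ : X ∣ P := by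
          rw [X_dvd_iff, coeff_zero_eq_aeval_zero]
          rw [hz0, ← map_zero (algebraMap ℝ ℂ), aeval_algebraMap_apply] at hz
          simpa using hz
        have hQ0 : Q ≠ 0 := right_ne_zero_of_mul hP0
        have hQ := ih Q.natDegree (by rw [← hd, natDegree_X_mul hQ0]; omega) Q
          (by simpa using hlead) (fun w _ hw => hroots w hP0 (by simp [hw])) rfl
        refine ⟨hQ.2.mul_linear le_rfl (by simp) fun k => ?_, ?_⟩
        · simp only [zero_mul, add_zero]
          rw [show 2 * (k + 1) = 2 * k + 1 + 1 by ring, coeff_X_mul]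
        · simpa only [coeff_X_mul] using hQ.1
      · obtain ⟨Q, rfl⟩ := quadratic_dvd_of_aeval_eq_zero_im_ne_zero P hz him
        rw [hre, mul_zero, map_zero, zero_mul, sub_zero] at *
        set r : ℝ := ‖z‖ ^ 2 with hr
        have hr0 : 0 ≤ r := by positivity
        have hQ0 : Q ≠ 0 := right_ne_zero_of_mul hP0
        have hmon : (X ^ 2 + C r : ℝ[X]).Monic := monic_X_pow_add_C r two_ne_zero
        have hQ := ih Q.natDegree
          (by rw [← hd, hmon.natDegree_mul' hQ0, natDegree_X_pow_add_C]; omega) Q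
          (by rwa [leadingCoeff_mul, hmon.leadingCoeff, one_mul] at hlead)
          (fun w _ hw => hroots w hP0 (by simp [hw])) rfl
        refine ⟨hQ.1.mul_linear hr0 ?_ fun k => ?_, hQ.2.mul_linear hr0 ?_ fun k => ?_⟩
        · simp [add_mul]
        · rw [show 2 * (k + 1) = 2 * k + 2 by ring, add_mul, coeff_add, coeff_X_pow_mul,
            coeff_C_mul]
        · simp [add_mul, coeff_X_pow_mul']
        · rw [show 2 * (k + 1) + 1 = 2 * k + 1 + 2 by ring, add_mul, coeff_add, coeff_X_pow_mul,
            coeff_C_mul]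

end LogConcave

section Roots

/-- All complex roots lie on the vertical line `re z = c`; in particular the polynomial is
nonzero. -/
def RootsOnLine (Q : ℂ[X]) (c : ℝ) : Prop :=
  Q ≠ 0 ∧ ∀ z, Q.eval z = 0 → z.re = c

theorem multiset_prod_le_and_lt (s : Multiset ℂ) (f g : ℂ → ℝ) (hf : ∀ r ∈ s, 0 ≤ f r)
    (hfg : ∀ r ∈ s, f r < g r) :
    0 ≤ (s.map f).prod ∧ (s.map f).prod ≤ (s.map g).prod ∧ 0 < (s.map g).prod ∧
      (s ≠ 0 → (s.map f).prod < (s.map g).prod) := by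
  induction s using Multiset.induction_on with
  | empty => simp
  | cons r s ih =>
    obtain ⟨h1, h2, h3, -⟩ := ih (fun x hx => hf x (Multiset.mem_cons_of_mem hx))
      (fun x hx => hfg x (Multiset.mem_cons_of_mem hx))
    have hr := hf r (Multiset.mem_cons_self r s)
    have hr' := hfg r (Multiset.mem_cons_self r s)
    have hlt : f r * (s.map f).prod < g r * (s.map g).prod :=
      (mul_le_mul_of_nonneg_left h2 hr).trans_lt (mul_lt_mul_of_pos_right hr' h3)
    simp only [Multiset.map_cons, Multiset.prod_cons]
    exact ⟨mul_nonneg hr h1, hlt.le, mul_pos (hr.trans_lt hr') h3, fun _ => hlt⟩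

theorem norm_eval_lt_of_roots {Q : ℂ[X]} (hQ : Q ≠ 0) {x y : ℂ}
    (h : ∀ r, Q.eval r = 0 → ‖x - r‖ < ‖y - r‖) :
    Q.eval y ≠ 0 ∧ ‖Q.eval x‖ ≤ ‖Q.eval y‖ ∧ (Q.natDegree ≠ 0 → ‖Q.eval x‖ < ‖Q.eval y‖) := by
  have hev : ∀ w : ℂ, ‖Q.eval w‖ = ‖Q.leadingCoeff‖ * (Q.roots.map fun r => ‖w - r‖).prod := by
    intro w
    rw [(IsAlgClosed.splits Q).eval_eq_prod_roots, norm_mul]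
    congr 1
    exact (map_multiset_prod (normHom (α := ℂ)) _).trans (by rw [Multiset.map_map]; rfl)
  obtain ⟨-, h1, h2, h3⟩ := multiset_prod_le_and_lt Q.roots (fun r => ‖x - r‖) (fun r => ‖y - r‖)
    (fun _ _ => norm_nonneg _) fun r hr => h r ((mem_roots hQ).1 hr)
  have hl : 0 < ‖Q.leadingCoeff‖ := norm_pos_iff.2 (leadingCoeff_ne_zero.2 hQ)
  refine ⟨?_, ?_, fun hd => ?_⟩
  · rw [← norm_pos_iff, hev]
    exact mul_pos hl h2
  · rw [hev, hev]
    exact mul_le_mul_of_nonneg_left h1 hl.le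
  · rw [hev, hev]
    refine mul_lt_mul_of_pos_left (h3 fun h0 => hd ?_) hl
    rw [(IsAlgClosed.splits Q).natDegree_eq_card_roots, h0, Multiset.card_zero]

theorem norm_lt_norm_of_sq_re {x y : ℂ} (him : x.im = y.im) (hre : x.re ^ 2 < y.re ^ 2) :
    ‖x‖ < ‖y‖ := by
  rw [← sq_lt_sq₀ (norm_nonneg _) (norm_nonneg _), Complex.sq_norm, Complex.sq_norm,
    Complex.normSq_apply, Complex.normSq_apply, him]
  nlinarith

theorem RootsOnLine.norm_eval_sub_lt {Q : ℂ[X]} {c s : ℝ} (hQ : RootsOnLine Q c) (hs : 0 < s)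
    {z : ℂ} (hz : c + s / 2 < z.re) :
    Q.eval z ≠ 0 ∧ ‖Q.eval (z - s)‖ ≤ ‖Q.eval z‖ ∧
      (Q.natDegree ≠ 0 → ‖Q.eval (z - s)‖ < ‖Q.eval z‖) := by
  refine norm_eval_lt_of_roots hQ.1 fun r hr => norm_lt_norm_of_sq_re (by simp) ?_
  have := hQ.2 r hr
  simp only [Complex.sub_re, Complex.ofReal_re, this]
  nlinarith

theorem RootsOnLine.norm_eval_lt_sub {Q : ℂ[X]} {c s : ℝ} (hQ : RootsOnLine Q c) (hs : 0 < s)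
    {z : ℂ} (hz : z.re < c + s / 2) :
    Q.eval (z - s) ≠ 0 ∧ ‖Q.eval z‖ ≤ ‖Q.eval (z - s)‖ ∧
      (Q.natDegree ≠ 0 → ‖Q.eval z‖ < ‖Q.eval (z - s)‖) := by
  refine norm_eval_lt_of_roots hQ.1 fun r hr => norm_lt_norm_of_sq_re (by simp) ?_
  have := hQ.2 r hr
  simp only [Complex.sub_re, Complex.ofReal_re, this]
  nlinarith

theorem rootsOnLine_of_ne {T : ℂ[X]} {c : ℝ} (h1 : ∀ z : ℂ, c < z.re → T.eval z ≠ 0)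
    (h2 : ∀ z : ℂ, z.re < c → T.eval z ≠ 0) : RootsOnLine T c := by
  refine ⟨?_, fun z hz => ?_⟩
  · rintro rfl
    exact h1 ((c + 1 : ℝ) : ℂ) (by rw [Complex.ofReal_re]; linarith) (by simp)
  · rcases lt_trichotomy c z.re with h | h | h
    · exact absurd hz (h1 z h)
    · exact h.symm
    · exact absurd hz (h2 z h)

theorem add_ne_zero_of_norm_lt {x y : ℂ} (h : ‖x‖ < ‖y‖) : y + x ≠ 0 := by
  intro h0
  rw [add_eq_zero_iff_eq_neg] at h0
  rw [h0, norm_neg] at h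
  exact lt_irrefl _ h

/-- If `|B| < |A|` to the right of the line halfway between the roots of `Q(z)` and `Q(z - s)`, and
`|A| < |B|` to its left, then the roots of `A(z) Q(z) + B(z) Q(z - s)` lie on this line. -/
theorem RootsOnLine.mul_add_mul_comp {Q : ℂ[X]} {c s : ℝ} (hQ : RootsOnLine Q c) (hs : 0 < s)
    (A B : ℂ[X])
    (h1 : ∀ z : ℂ, c + s / 2 < z.re → ‖B.eval z‖ < ‖A.eval z‖)
    (h2 : ∀ z : ℂ, z.re < c + s / 2 → ‖A.eval z‖ < ‖B.eval z‖) :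
    RootsOnLine (A * Q + B * Q.comp (X - C (s : ℂ))) (c + s / 2) := by
  refine rootsOnLine_of_ne (fun z hz => ?_) (fun z hz => ?_)
  · obtain ⟨hne, hle, -⟩ := hQ.norm_eval_sub_lt hs hz
    have := (mul_le_mul_of_nonneg_left hle (norm_nonneg (B.eval z))).trans_lt
      (mul_lt_mul_of_pos_right (h1 z hz) (norm_pos_iff.2 hne))
    rw [← norm_mul, ← norm_mul] at this
    simpa using add_ne_zero_of_norm_lt this
  · obtain ⟨hne, hle, -⟩ := hQ.norm_eval_lt_sub hs hz
    have := (mul_le_mul_of_nonneg_left hle (norm_nonneg (A.eval z))).trans_lt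
      (mul_lt_mul_of_pos_right (h2 z hz) (norm_pos_iff.2 hne))
    rw [← norm_mul, ← norm_mul] at this
    simpa [add_comm] using add_ne_zero_of_norm_lt this

theorem RootsOnLine.sub_mul_comp {Q : ℂ[X]} {c s : ℝ} (hQ : RootsOnLine Q c) (hs : 0 < s)
    {u : ℂ} (hu : ‖u‖ = 1) (hu1 : u ≠ 1 ∨ Q.natDegree ≠ 0) :
    RootsOnLine (Q - C u * Q.comp (X - C (s : ℂ))) (c + s / 2) := by
  by_cases hd : Q.natDegree = 0
  · obtain ⟨a, rfl⟩ := natDegree_eq_zero.1 hd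
    have ha : a ≠ 0 := fun h => hQ.1 (by rw [h, map_zero])
    have hu1 : u ≠ 1 := hu1.resolve_right (fun h => h hd)
    have h : ∀ z : ℂ, eval z (C a - C u * (C a).comp (X - C (s : ℂ))) ≠ 0 := by
      intro z
      rw [eval_sub, eval_mul, C_comp, eval_C, eval_C, ← one_sub_mul]
      exact mul_ne_zero (sub_ne_zero.2 hu1.symm) ha
    exact rootsOnLine_of_ne (fun z _ => h z) (fun z _ => h z)
  · refine rootsOnLine_of_ne (fun z hz => ?_) (fun z hz => ?_) <;>
    rw [eval_sub, sub_ne_zero] <;> intro h <;> have := congrArg norm h <;>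
    simp only [eval_mul, eval_C, norm_mul, hu, one_mul, eval_comp, eval_sub, eval_X] at this
    · exact ((hQ.norm_eval_sub_lt hs hz).2.2 hd).ne' this
    · exact ((hQ.norm_eval_lt_sub hs hz).2.2 hd).ne this

end Roots

section Coefficients

theorem coeff_geomSer_pow (M q : ℕ) : PowerSeries.coeff q (geomSer ^ (M + 1)) =
    (∏ i ∈ Finset.range M, ((q : ℂ) + 1 + i)) * ((M.factorial : ℂ))⁻¹ := by
  have hM : (M.factorial : ℂ) ≠ 0 := Nat.cast_ne_zero.2 M.factorial_ne_zero
  rw [geomSer, PowerSeries.mk_one_pow_eq_mk_choose_add, PowerSeries.coeff_mk,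
    eq_mul_inv_iff_mul_eq₀ hM]
  have h := Nat.ascFactorial_eq_factorial_mul_choose q M
  rw [Nat.ascFactorial_eq_prod_range, mul_comm, add_comm q M] at h
  rw [← Nat.cast_mul, ← h]
  push_cast
  rfl

/-- The coefficients are eventually `(q + 1) ⋯ (q + j) Q(q)`, where the roots of `Q` lie on
`re z = c`. -/
def CoeffOnLine (f : PowerSeries ℂ) (j : ℕ) (c : ℝ) : Prop :=
  ∃ Q : ℂ[X], RootsOnLine Q c ∧ ∃ N, ∀ q, N ≤ q →
    PowerSeries.coeff q f = (∏ i ∈ Finset.range j, ((q : ℂ) + 1 + i)) * Q.eval (q : ℂ)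

theorem coeffOnLine_geomSer_pow (M : ℕ) (c : ℝ) : CoeffOnLine (geomSer ^ (M + 1)) M c := by
  have hM : (M.factorial : ℂ)⁻¹ ≠ 0 := inv_ne_zero (Nat.cast_ne_zero.2 M.factorial_ne_zero)
  refine ⟨C (M.factorial : ℂ)⁻¹, ⟨C_ne_zero.2 hM, fun z hz => absurd hz ?_⟩, 0, fun q _ => ?_⟩
  · rwa [eval_C]
  · rw [coeff_geomSer_pow, eval_C]

theorem coeff_succ_one_sub_mul (f : PowerSeries ℂ) (u : ℂ) (q : ℕ) :
    PowerSeries.coeff (q + 1) ((1 - PowerSeries.C u * PowerSeries.X) * f) =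
      PowerSeries.coeff (q + 1) f - u * PowerSeries.coeff q f := by
  rw [sub_mul, one_mul, map_sub, mul_assoc, PowerSeries.coeff_C_mul, PowerSeries.coeff_succ_X_mul]

theorem CoeffOnLine.one_sub_mul_succ {f : PowerSeries ℂ} {j : ℕ}
    (hf : CoeffOnLine f (j + 1) (-(((j + 1 : ℕ) : ℝ) + 1) / 2)) {u : ℂ} (hu : ‖u‖ = 1) :
    CoeffOnLine ((1 - PowerSeries.C u * PowerSeries.X) * f) j (-((j : ℝ) + 1) / 2) := by
  obtain ⟨Q, hQ, N, hN⟩ := hf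
  have hc : -(((j + 1 : ℕ) : ℝ) + 1) / 2 + 1 / 2 = -((j : ℝ) + 1) / 2 := by push_cast; ring
  refine ⟨(X + C ((j : ℂ) + 1)) * Q + (-C u * X) * Q.comp (X - C ((1 : ℝ) : ℂ)), ?_, N + 1,
    fun q hq => ?_⟩
  · rw [← hc]
    apply hQ.mul_add_mul_comp one_pos
    all_goals
      intro z hz
      have hj : (0 : ℝ) < j + 1 := j.cast_add_one_pos
      rw [hc] at hz
      simp only [eval_mul, eval_neg, eval_C, eval_X, eval_add, norm_mul, norm_neg, hu, one_mul]
      refine norm_lt_norm_of_sq_re (by simp) ?_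
      simp only [Complex.add_re, Complex.natCast_re, Complex.one_re]
      first
        | nlinarith [mul_pos hj (show 0 < 2 * z.re + (j + 1) by linarith)]
        | nlinarith [mul_pos hj (show 0 < -(2 * z.re + (j + 1)) by linarith)]
  · obtain ⟨p, rfl⟩ : ∃ p, q = p + 1 := ⟨q - 1, by omega⟩
    rw [coeff_succ_one_sub_mul, hN _ (by omega), hN _ (by omega), Finset.prod_range_succ,
      Finset.prod_range_succ' (fun i : ℕ => (p : ℂ) + 1 + i)]
    have : ∏ i ∈ Finset.range j, ((p : ℂ) + 1 + ((i + 1 : ℕ) : ℂ)) =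
        ∏ i ∈ Finset.range j, (((p + 1 : ℕ) : ℂ) + 1 + i) :=
      Finset.prod_congr rfl fun i _ => by push_cast; ring
    rw [this]
    simp only [eval_add, eval_mul, eval_neg, eval_comp, eval_sub, eval_X, eval_C]
    push_cast
    rw [add_sub_cancel_right]
    ring

theorem CoeffOnLine.one_sub_mul_zero {f : PowerSeries ℂ} {c : ℝ} (hf : CoeffOnLine f 0 c) {u : ℂ}
    (hu : ‖u‖ = 1) (hu1 : u ≠ 1) :
    CoeffOnLine ((1 - PowerSeries.C u * PowerSeries.X) * f) 0 (c + 1 / 2) := by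
  obtain ⟨Q, hQ, N, hN⟩ := hf
  refine ⟨_, hQ.sub_mul_comp one_pos hu (Or.inl hu1), N + 1, fun q hq => ?_⟩
  obtain ⟨p, rfl⟩ : ∃ p, q = p + 1 := ⟨q - 1, by omega⟩
  rw [coeff_succ_one_sub_mul, hN _ (by omega), hN _ (by omega)]
  simp

theorem CoeffOnLine.prod_mul {f : PowerSeries ℂ} {j : ℕ} (U : Multiset ℂ)
    (hU : ∀ u ∈ U, ‖u‖ = 1)
    (hf : CoeffOnLine f (j + U.card) (-(((j + U.card : ℕ) : ℝ) + 1) / 2)) :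
    CoeffOnLine ((U.map fun u => 1 - PowerSeries.C u * PowerSeries.X).prod * f) j
      (-((j : ℝ) + 1) / 2) := by
  induction U using Multiset.induction_on generalizing j with
  | empty => simpa using hf
  | cons u U ih =>
    rw [Multiset.map_cons, Multiset.prod_cons, mul_assoc]
    refine (ih (j := j + 1) (fun x hx => hU x (Multiset.mem_cons_of_mem hx)) ?_).one_sub_mul_succ
      (hU u (Multiset.mem_cons_self _ _))
    rwa [Multiset.card_cons, ← add_assoc, add_right_comm] at hf

theorem exists_one_sub_X_pow_eq {b : ℕ} (hb : 0 < b) : ∃ U : Multiset ℂ, U.card + 1 = b ∧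
    (∀ u ∈ U, ‖u‖ = 1 ∧ u ≠ 1) ∧ (1 - PowerSeries.X ^ b : PowerSeries ℂ) =
      (1 - PowerSeries.X) * (U.map fun u => 1 - PowerSeries.C u * PowerSeries.X).prod := by
  have hprim := Complex.isPrimitiveRoot_exp b hb.ne'
  set S := nthRootsFinset b (1 : ℂ) with hS
  have h1 : (1 : ℂ) ∈ S := by rw [hS, mem_nthRootsFinset hb]; simp
  refine ⟨(S.erase 1).val, ?_, fun u hu => ?_, ?_⟩
  · rw [Finset.card_val, Finset.card_erase_add_one h1, hS, hprim.card_nthRootsFinset]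
  · obtain ⟨hu1, hu⟩ := Finset.mem_erase.1 (show u ∈ S.erase 1 from hu)
    rw [mem_nthRootsFinset hb] at hu
    exact ⟨Complex.norm_eq_one_of_pow_eq_one hu hb.ne', hu1⟩
  · have hpoly : (1 - X ^ b : ℂ[X]) = ∏ u ∈ S, (1 - C u * X) := by
      apply Polynomial.funext
      intro x
      have := hprim.pow_sub_pow_eq_prod_sub_mul 1 x hb
      simpa [eval_prod] using this
    have := congrArg (Polynomial.coeToPowerSeries.ringHom (R := ℂ)) hpoly
    rw [map_prod, ← Finset.mul_prod_erase _ _ h1] at this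
    rw [← Finset.prod_eq_multiset_prod]
    simpa using this

theorem exists_prod_one_sub_X_pow_eq (β : Multiset ℕ) (hβ : ∀ b ∈ β, 0 < b) :
    ∃ U : Multiset ℂ, U.card + β.card = β.sum ∧ (∀ u ∈ U, ‖u‖ = 1 ∧ u ≠ 1) ∧
      (β.map fun b => (1 - PowerSeries.X ^ b : PowerSeries ℂ)).prod =
        (1 - PowerSeries.X) ^ β.card *
          (U.map fun u => 1 - PowerSeries.C u * PowerSeries.X).prod := by
  induction β using Multiset.induction_on with
  | empty => exact ⟨0, by simp⟩
  | cons b β ih =>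
    obtain ⟨U, h1, h2, h3⟩ := ih fun x hx => hβ x (Multiset.mem_cons_of_mem hx)
    obtain ⟨V, h4, h5, h6⟩ := exists_one_sub_X_pow_eq (hβ b (Multiset.mem_cons_self _ _))
    refine ⟨V + U, ?_, fun u hu => (Multiset.mem_add.1 hu).elim (h5 u) (h2 u), ?_⟩
    · simp only [Multiset.card_add, Multiset.card_cons, Multiset.sum_cons]
      omega
    · rw [Multiset.map_cons, Multiset.prod_cons, h3, h6, Multiset.map_add, Multiset.prod_add,
        Multiset.card_cons]
      ring

theorem coeffOnLine_of_three_le {n : ℕ} (hn : 2 ≤ n) (β : Multiset ℕ) (hsum : β.sum = n)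
    (hβ : ∀ b ∈ β, 3 ≤ b) :
    CoeffOnLine ((β.map fun b => (1 - PowerSeries.X ^ b : PowerSeries ℂ)).prod *
      geomSer ^ (n - 1)) 0 (1 / 2) := by
  obtain ⟨U, h1, h2, h3⟩ := exists_prod_one_sub_X_pow_eq β fun b hb => by have := hβ b hb; omega
  have hcard : β.card * 3 ≤ n := by
    have := Multiset.card_nsmul_le_sum hβ
    rwa [hsum, smul_eq_mul] at this
  obtain ⟨u, hu⟩ : ∃ u, u ∈ U := (Multiset.card_pos_iff_exists_mem (s := U)).1 (by omega)
  obtain ⟨U, rfl⟩ := Multiset.exists_cons_of_mem hu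
  rw [Multiset.card_cons] at h1
  obtain ⟨v, hv⟩ : ∃ v, v ∈ U := (Multiset.card_pos_iff_exists_mem (s := U)).1 (by omega)
  obtain ⟨U, rfl⟩ := Multiset.exists_cons_of_mem hv
  rw [Multiset.card_cons] at h1
  have hexp : n - 1 = β.card + (U.card + 1) := by omega
  have hser : (β.map fun b => (1 - PowerSeries.X ^ b : PowerSeries ℂ)).prod * geomSer ^ (n - 1) =
      (1 - PowerSeries.C u * PowerSeries.X) * ((1 - PowerSeries.C v * PowerSeries.X) *
        ((U.map fun u => 1 - PowerSeries.C u * PowerSeries.X).prod * geomSer ^ (U.card + 1))) := by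
    have h : (1 - PowerSeries.X : PowerSeries ℂ) ^ β.card * geomSer ^ β.card = 1 := by
      rw [← mul_pow, one_sub_mul_geomSer, one_pow]
    rw [h3, hexp, pow_add, Multiset.map_cons, Multiset.prod_cons, Multiset.map_cons,
      Multiset.prod_cons]
    linear_combination ((1 - PowerSeries.C u * PowerSeries.X) *
      ((1 - PowerSeries.C v * PowerSeries.X) *
        ((U.map fun u => 1 - PowerSeries.C u * PowerSeries.X).prod * geomSer ^ (U.card + 1)))) * h
  have hu' := h2 u (by simp)
  have hv' := h2 v (by simp)
  have hbase : CoeffOnLine ((U.map fun u => 1 - PowerSeries.C u * PowerSeries.X).prod *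
      geomSer ^ (U.card + 1)) 0 (-(((0 : ℕ) : ℝ) + 1) / 2) :=
    CoeffOnLine.prod_mul U (fun x hx => (h2 x (by simp [hx])).1)
      (by rw [zero_add]; exact coeffOnLine_geomSer_pow _ _)
  rw [hser]
  convert (hbase.one_sub_mul_zero hv'.1 hv'.2).one_sub_mul_zero hu'.1 hu'.2 using 1
  norm_num

end Coefficients

section Main

variable {n : ℕ}

theorem card_fixed_eq_count (ω : Equiv.Perm (Fin n)) :
    (Finset.univ.filter fun a => ω a = a).card = (fullCycleType ω).count 1 := by
  have h1 : ω.cycleType.count 1 = 0 := Multiset.count_eq_zero.2 fun h =>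
    absurd (Equiv.Perm.two_le_of_mem_cycleType h) (by norm_num)
  have h2 : (Finset.univ.filter fun a => ω a = a) = ω.supportᶜ := by
    ext a
    simp
  rw [h2, Finset.card_compl, Fintype.card_fin, fullCycleType, Multiset.count_add, h1,
    Multiset.count_replicate_self, zero_add, Equiv.Perm.sum_cycleType]

theorem two_mem_fullCycleType {ω : Equiv.Perm (Fin n)} {a : Fin n} (ha : ω a ≠ a)
    (h : ω (ω a) = a) : 2 ∈ fullCycleType ω := by
  refine Multiset.mem_add.2 (Or.inl ?_)
  have hcyc := Equiv.Perm.isCycle_cycleOf ω ha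
  have happ : ω.cycleOf a a = ω a := Equiv.Perm.cycleOf_apply_self ω a
  have hsw : ω.cycleOf a = Equiv.swap a (ω a) := by
    rw [← happ]
    refine hcyc.eq_swap_of_apply_apply_eq_self (by rwa [happ]) ?_
    rw [happ, (Equiv.Perm.SameCycle.refl ω a).apply_right.cycleOf_apply, h]
  rw [Equiv.Perm.cycleType_def, Multiset.mem_map]
  refine ⟨ω.cycleOf a, ?_, ?_⟩
  · rw [Finset.mem_val]
    exact Equiv.Perm.cycleOf_mem_cycleFactorsFinset_iff.2 (Equiv.Perm.mem_support.2 ha)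
  rw [Function.comp_apply, hsw, Equiv.Perm.card_support_swap (Ne.symm ha)]

theorem coeff_serD (f : PowerSeries ℂ) (q : ℕ) :
    PowerSeries.coeff q (serD f) = PowerSeries.coeff (q + 1) f * (q + 1) :=
  PowerSeries.coeff_derivative f q

theorem mk_sum_class_eq (hn : 6 ≤ n) (ω : Equiv.Perm (Fin n)) (h2 : 2 ∉ fullCycleType ω)
    (h1 : (fullCycleType ω).count 1 ≤ 1) :
    PowerSeries.mk (fun q => 2 * ∑ α ∈ Finset.univ.filter
        (fun α : Equiv.Perm (Fin n) => fullCycleType α = {2, n - 2}), (q : ℂ) ^ numCycles (α * ω)) =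
      ((n - 3).factorial : PowerSeries ℂ) * PowerSeries.X *
        ((1 + PowerSeries.X) * serD (serD (((fullCycleType ω).map
            fun b => (1 - PowerSeries.X ^ b : PowerSeries ℂ)).prod * geomSer ^ (n - 1))) +
          2 * ((fullCycleType ω).count 1 : PowerSeries ℂ) *
            serD (((fullCycleType ω).map
              fun b => (1 - PowerSeries.X ^ b : PowerSeries ℂ)).prod * geomSer ^ n)) := by
  rw [← cycleDet_X_eq, ← card_fixed_eq_count, ← sum_pairSeries (by omega)
    (fun a ha h => h2 (two_mem_fullCycleType ha h))]
  · ext q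
    simp only [map_sum, pairSeries, PowerSeries.coeff_mk]
    rw [← sum_pairs_cyc hn (fun α => (q : ℂ) ^ numCycles (α * ω))]
  · rw [← card_fixed_eq_count] at h1
    exact fun a b ha hb => Finset.card_le_one.1 h1 a (by simpa using ha) b (by simpa using hb)

theorem exists_poly_of_three_le (hn : 6 ≤ n) (β : Multiset ℕ) (hsum : β.sum = n)
    (hβ : ∀ b ∈ β, 3 ≤ b) :
    ∃ T : ℂ[X], RootsOnLine T 0 ∧ ∃ N, ∀ q : ℕ, N ≤ q → ∀ ω : Equiv.Perm (Fin n),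
      fullCycleType ω = β → ∑ α ∈ Finset.univ.filter
        (fun α : Equiv.Perm (Fin n) => fullCycleType α = {2, n - 2}), (q : ℂ) ^ numCycles (α * ω) =
          T.eval (q : ℂ) := by
  obtain ⟨Q, hQ, N, hN⟩ := coeffOnLine_of_three_le (by omega) β hsum hβ
  have hline := hQ.mul_add_mul_comp one_pos X (X - C 2) (fun z hz => ?_) (fun z hz => ?_)
  · set T₁ := X * Q + (X - C 2) * Q.comp (X - C ((1 : ℝ) : ℂ)) with hT₁
    have hf : ((n - 3).factorial / 2 : ℂ) ≠ 0 :=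
      div_ne_zero (Nat.cast_ne_zero.2 (Nat.factorial_ne_zero _)) two_ne_zero
    refine ⟨C ((n - 3).factorial / 2 : ℂ) * (X * T₁.comp (X + C 1)), ⟨?_, fun z hz => ?_⟩, N + 2,
      fun q hq ω hω => ?_⟩
    · refine mul_ne_zero (C_ne_zero.2 hf) (mul_ne_zero X_ne_zero fun h => ?_)
      rcases comp_eq_zero_iff.1 h with h | h
      · exact hline.1 h
      · have := congrArg (coeff · 1) h.2
        simp [coeff_X, coeff_one] at this
    · rw [eval_mul, eval_C, eval_mul, eval_X, mul_eq_zero, mul_eq_zero] at hz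
      rcases hz with h | h | h
      · exact absurd h hf
      · rw [h, Complex.zero_re]
      · rw [eval_comp] at h
        have := hline.2 _ h
        simp at this
        linarith
    · have h := mk_sum_class_eq hn ω (by rw [hω]; exact fun h => by have := hβ 2 h; omega)
        (by rw [hω, Multiset.count_eq_zero.2 fun h => by have := hβ 1 h; omega]; exact zero_le_one)
      rw [hω, Multiset.count_eq_zero.2 fun h => by have := hβ 1 h; omega] at h
      obtain ⟨p, rfl⟩ : ∃ p, q = p + 2 := ⟨q - 2, by omega⟩
      have h := congrArg (PowerSeries.coeff (p + 2)) h
      rw [PowerSeries.coeff_mk, ← map_natCast (PowerSeries.C (R := ℂ)), mul_assoc,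
        PowerSeries.coeff_C_mul, PowerSeries.coeff_succ_X_mul, Nat.cast_zero, mul_zero, zero_mul,
        add_zero, add_mul, one_mul, map_add, PowerSeries.coeff_succ_X_mul] at h
      simp only [coeff_serD] at h
      rw [hN _ (by omega), hN _ (by omega)] at h
      simp only [Finset.range_zero, Finset.prod_empty, one_mul] at h
      simp only [hT₁, eval_mul, eval_C, eval_X, eval_comp, eval_add, eval_sub]
      have h11 : (p : ℂ) + 1 + 1 = p + 2 := by ring
      push_cast at h ⊢
      rw [h11] at h
      rw [add_sub_cancel_right]
      linear_combination h / 2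
  · rw [eval_X, eval_sub, eval_X, eval_C]
    refine norm_lt_norm_of_sq_re (by simp) ?_
    simp only [Complex.sub_re, Complex.re_ofNat]
    nlinarith
  · rw [eval_X, eval_sub, eval_X, eval_C]
    refine norm_lt_norm_of_sq_re (by simp) ?_
    simp only [Complex.sub_re, Complex.re_ofNat]
    nlinarith

theorem norm_prod_lt_norm_prod (N : ℕ) {z : ℂ} (hz : 0 < z.re) :
    ‖∏ i ∈ Finset.range (N + 1), (z - (1 + i))‖ < ‖∏ i ∈ Finset.range (N + 1), (z + (1 + i))‖ := by
  have h : ∀ i : ℕ, ‖z - (1 + i)‖ < ‖z + (1 + i)‖ := by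
    intro i
    refine norm_lt_norm_of_sq_re (by simp) ?_
    simp only [Complex.sub_re, Complex.add_re, Complex.one_re, Complex.natCast_re]
    nlinarith [mul_pos hz (i.cast_add_one_pos (α := ℝ))]
  induction N with
  | zero => simpa using h 0
  | succ N ih =>
    rw [Finset.prod_range_succ, Finset.prod_range_succ _ (N + 1), norm_mul, norm_mul]
    exact mul_lt_mul'' ih (h _) (norm_nonneg _) (norm_nonneg _)

theorem rootsOnLine_prod_sub_prod (N : ℕ) :
    RootsOnLine (∏ i ∈ Finset.range (N + 1), (X + C (1 + i : ℂ)) -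
      ∏ i ∈ Finset.range (N + 1), (X - C (1 + i : ℂ))) 0 := by
  refine rootsOnLine_of_ne (fun z hz h => ?_) (fun z hz h => ?_) <;>
    simp only [eval_sub, eval_prod, eval_add, eval_X, eval_C, sub_eq_zero] at h
  · have := norm_prod_lt_norm_prod N hz
    rw [h] at this
    exact lt_irrefl _ this
  · have := norm_prod_lt_norm_prod N (z := -z) (by simpa using hz)
    have e1 : ∀ i : ℕ, -z - (1 + i) = -(z + (1 + i)) := fun i => by ring
    have e2 : ∀ i : ℕ, -z + (1 + i) = -(z - (1 + i)) := fun i => by ring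
    simp only [e1, e2, norm_prod, norm_neg] at this
    rw [← norm_prod, ← norm_prod, h] at this
    exact lt_irrefl _ this

theorem coeff_one_sub_X_pow_mul (N q : ℕ) (hq : N + 2 ≤ q) :
    PowerSeries.coeff q ((1 - PowerSeries.X ^ (N + 2)) * geomSer ^ (N + 2)) =
      (((N + 1).factorial : ℂ))⁻¹ * (∏ i ∈ Finset.range (N + 1), (X + C (1 + i : ℂ)) -
        ∏ i ∈ Finset.range (N + 1), (X - C (1 + i : ℂ))).eval (q : ℂ) := by
  rw [sub_mul, one_mul, map_sub, PowerSeries.coeff_X_pow_mul', if_pos hq, coeff_geomSer_pow,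
    coeff_geomSer_pow, ← Finset.prod_range_reflect (fun i : ℕ => ((q - (N + 2) : ℕ) : ℂ) + 1 + i)]
  have : ∏ i ∈ Finset.range (N + 1), (((q - (N + 2) : ℕ) : ℂ) + 1 + ((N + 1 - 1 - i : ℕ) : ℂ)) =
      ∏ i ∈ Finset.range (N + 1), ((q : ℂ) - (1 + i)) := by
    refine Finset.prod_congr rfl fun i hi => ?_
    have := Finset.mem_range.1 hi
    rw [Nat.cast_sub hq, Nat.cast_sub (by omega), Nat.cast_sub (by omega)]
    push_cast
    ring
  rw [this]
  simp only [eval_sub, eval_prod, eval_add, eval_X, eval_C, add_assoc]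
  ring

theorem exists_poly_of_near_full (hn : 6 ≤ n) :
    ∃ T : ℂ[X], RootsOnLine T 0 ∧ ∃ N, ∀ q : ℕ, N ≤ q → ∀ ω : Equiv.Perm (Fin n),
      fullCycleType ω = {1, n - 1} → ∑ α ∈ Finset.univ.filter
        (fun α : Equiv.Perm (Fin n) => fullCycleType α = {2, n - 2}), (q : ℂ) ^ numCycles (α * ω) =
          T.eval (q : ℂ) := by
  obtain ⟨N, hnN⟩ : ∃ N, n = N + 3 := ⟨n - 3, by omega⟩
  set v := ∏ i ∈ Finset.range (N + 1), (X + C (1 + i : ℂ)) -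
    ∏ i ∈ Finset.range (N + 1), (X - C (1 + i : ℂ)) with hv
  have hvl : RootsOnLine v 0 := rootsOnLine_prod_sub_prod N
  set g := (X * v).comp (X + C 1) with hg
  have hdeg : (X * v).natDegree ≠ 0 := by
    rw [natDegree_X_mul hvl.1]
    omega
  have hgd : g.natDegree ≠ 0 := by
    rwa [hg, natDegree_comp, natDegree_X_add_C, mul_one]
  have hgl : RootsOnLine g (-1) := by
    refine ⟨fun h => hgd (by rw [h, natDegree_zero]), fun z hz => ?_⟩
    rw [hg, eval_comp, eval_mul, eval_X, mul_eq_zero] at hz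
    have : (z + 1).re = 0 := by
      rcases hz with h | h
      · simpa using congrArg Complex.re h
      · simpa using hvl.2 _ h
    simp at this
    linarith
  have hline := hgl.sub_mul_comp two_pos norm_one (Or.inr hgd)
  set T₁ := g - C 1 * g.comp (X - C ((2 : ℝ) : ℂ)) with hT₁
  have hf : ((N.factorial : ℂ) / 2 * ((N + 1).factorial : ℂ)⁻¹) ≠ 0 :=
    mul_ne_zero (div_ne_zero (Nat.cast_ne_zero.2 (Nat.factorial_ne_zero _)) two_ne_zero)
      (inv_ne_zero (Nat.cast_ne_zero.2 (Nat.factorial_ne_zero _)))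
  refine ⟨C ((N.factorial : ℂ) / 2 * ((N + 1).factorial : ℂ)⁻¹) * (X * T₁), ⟨?_, fun z hz => ?_⟩,
    N + 3, fun q hq ω hω => ?_⟩
  · exact mul_ne_zero (C_ne_zero.2 hf) (mul_ne_zero X_ne_zero hline.1)
  · rw [eval_mul, eval_C, eval_mul, eval_X, mul_eq_zero] at hz
    rcases mul_eq_zero.1 (hz.resolve_left hf) with h | h
    · rw [h, Complex.zero_re]
    · have := hline.2 _ h
      linarith
  · have hcount : ({1, n - 1} : Multiset ℕ).count 1 = 1 := by
      rw [Multiset.insert_eq_cons, Multiset.count_cons_self, Multiset.count_singleton,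
        if_neg (by omega)]
    have h := mk_sum_class_eq hn ω (by rw [hω]; simp; omega) (by rw [hω, hcount])
    rw [hω, hcount] at h
    set V := (1 - PowerSeries.X ^ (N + 2) : PowerSeries ℂ) * geomSer ^ (N + 2) with hV
    have e1 : ((({1, n - 1} : Multiset ℕ)).map
        fun b => (1 - PowerSeries.X ^ b : PowerSeries ℂ)).prod * geomSer ^ (n - 1) =
          (1 - PowerSeries.X) * V := by
      rw [hV, hnN]
      simp [mul_assoc]
    have e2 : ((({1, n - 1} : Multiset ℕ)).map
        fun b => (1 - PowerSeries.X ^ b : PowerSeries ℂ)).prod * geomSer ^ n = V := by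
      rw [show n = (n - 1) + 1 by omega, pow_succ, ← mul_assoc, Nat.add_sub_cancel, e1]
      linear_combination V * one_sub_mul_geomSer
    have e3 : ((n - 3).factorial : PowerSeries ℂ) * PowerSeries.X *
        ((1 + PowerSeries.X) * serD (serD ((1 - PowerSeries.X) * V)) +
          2 * ((1 : ℕ) : PowerSeries ℂ) * serD V) = PowerSeries.C (N.factorial : ℂ) *
        (PowerSeries.X * serD (serD V) - PowerSeries.X ^ 3 * serD (serD V) -
          2 * (PowerSeries.X ^ 2 * serD V)) := by
      rw [show n - 3 = N by omega, map_natCast]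
      simp only [Derivation.leibniz, map_sub, map_add, Derivation.map_one_eq_zero, map_zero, serD_X,
        smul_eq_mul]
      push_cast
      ring
    rw [e1, e2, e3] at h
    obtain ⟨p, rfl⟩ : ∃ p, q = p + 3 := ⟨q - 3, by omega⟩
    have h := congrArg (PowerSeries.coeff (p + 3)) h
    have h22 : (2 : PowerSeries ℂ) = PowerSeries.C 2 := (map_ofNat _ 2).symm
    rw [PowerSeries.coeff_mk, PowerSeries.coeff_C_mul, map_sub, map_sub,
      PowerSeries.coeff_succ_X_mul, PowerSeries.coeff_X_pow_mul, h22, PowerSeries.coeff_C_mul,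
      show p + 3 = p + 1 + 2 by ring, PowerSeries.coeff_X_pow_mul] at h
    simp only [coeff_serD] at h
    rw [coeff_one_sub_X_pow_mul N _ (by omega), coeff_one_sub_X_pow_mul N _ (by omega), ← hv] at h
    have h1 : (p : ℂ) + 1 + 2 = p + 3 := by ring
    have h2 : (p : ℂ) + 2 + 1 + 1 = p + 3 + 1 := by ring
    have h3 : (p : ℂ) + 3 - 2 + 1 = p + 1 + 1 := by ring
    simp only [hT₁, hg, eval_mul, eval_C, eval_X, eval_comp, eval_add, eval_sub]
    push_cast at h ⊢
    rw [h1, h2] at h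
    rw [h3]
    linear_combination h / 2

end Main

/-- log-concavity and unimodality of the odd- and even-indexed subsequences of
`ξ_{n,m}`, the number of pairs `(σ,ω)` with `ρ(σ)=[2,n−2]`, `ρ(ω)=β`, `κ(σω)=m`. -/
theorem xi_log_concave_unimodal (n : ℕ) (hn : 6 ≤ n) (β : Multiset ℕ)
    (hsum : β.sum = n)
    (hβ : (∀ b ∈ β, 3 ≤ b) ∨ β = ({1, n - 1} : Multiset ℕ))
    (ξ : ℕ → ℕ)
    (hξ : ∀ m, ξ m =
      (Finset.univ.filter
        (fun p : Equiv.Perm (Fin n) × Equiv.Perm (Fin n) =>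
          fullCycleType p.1 = ({2, n - 2} : Multiset ℕ) ∧ fullCycleType p.2 = β ∧
            numCycles (p.1 * p.2) = m)).card) :
    (∀ k, ξ (2 * k + 1) * ξ (2 * k + 5) ≤ ξ (2 * k + 3) ^ 2) ∧
    (∀ k, ξ (2 * k + 2) * ξ (2 * k + 6) ≤ ξ (2 * k + 4) ^ 2) ∧
    (∃ t, (∀ k < t, ξ (2 * k + 1) ≤ ξ (2 * k + 3)) ∧
      (∀ k, t ≤ k → ξ (2 * k + 3) ≤ ξ (2 * k + 1))) ∧
    (∃ t, (∀ k < t, ξ (2 * k + 2) ≤ ξ (2 * k + 4)) ∧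
      (∀ k, t ≤ k → ξ (2 * k + 4) ≤ ξ (2 * k + 2))) := by
  obtain ⟨T, hT, N, hN⟩ : ∃ T : ℂ[X], RootsOnLine T 0 ∧ ∃ N, ∀ q : ℕ, N ≤ q →
      ∀ ω : Equiv.Perm (Fin n), fullCycleType ω = β → ∑ α ∈ Finset.univ.filter
        (fun α : Equiv.Perm (Fin n) => fullCycleType α = {2, n - 2}), (q : ℂ) ^ numCycles (α * ω) =
          T.eval (q : ℂ) := by
    rcases hβ with hβ | rfl
    · exact exists_poly_of_three_le hn β hsum hβ
    · exact exists_poly_of_near_full hn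
  set A := Finset.univ.filter fun α : Equiv.Perm (Fin n) => fullCycleType α = {2, n - 2} with hA
  set B := Finset.univ.filter fun ω : Equiv.Perm (Fin n) => fullCycleType ω = β with hB
  set P : ℝ[X] := ∑ ω ∈ B, ∑ α ∈ A, X ^ numCycles (α * ω) with hP
  have hcoeff : ∀ m, P.coeff m = ξ m := by
    intro m
    have h : (Finset.univ.filter fun p : Equiv.Perm (Fin n) × Equiv.Perm (Fin n) =>
        fullCycleType p.1 = ({2, n - 2} : Multiset ℕ) ∧ fullCycleType p.2 = β ∧
          numCycles (p.1 * p.2) = m) = (A ×ˢ B).filter fun p => m = numCycles (p.1 * p.2) := by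
      ext p
      simp [hA, hB, and_assoc, eq_comm]
    rw [hξ, h, hP, Finset.card_filter, Finset.sum_product_right]
    simp [finsetSum_coeff, coeff_X_pow]
  have hmap : P.map (algebraMap ℝ ℂ) = C (B.card : ℂ) * T := by
    refine eq_of_infinite_eval_eq _ _ (Set.Infinite.mono (s := (Nat.cast : ℕ → ℂ) '' Set.Ici N) ?_
      ((Set.Ici_infinite N).image Nat.cast_injective.injOn))
    rintro _ ⟨q, hq, rfl⟩
    simp only [hP, Polynomial.map_sum, Polynomial.map_pow, map_X, eval_finsetSum, eval_pow, eval_X,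
      Set.mem_ofPred_eq, eval_mul, eval_C]
    rw [Finset.sum_congr rfl fun ω hω => hN q hq ω (Finset.mem_filter.1 hω).2, Finset.sum_const,
      nsmul_eq_mul]
  obtain ⟨he, ho⟩ := isPF2_coeff_of_roots P (by rw [leadingCoeff, hcoeff]; positivity)
    fun z hP0 hz => by
      have hB0 : (B.card : ℂ) ≠ 0 := by
        intro h
        rw [h, map_zero, zero_mul, Polynomial.map_eq_zero] at hmap
        exact hP0 hmap
      rw [← eval_map_algebraMap, hmap, eval_mul, eval_C] at hz
      exact hT.2 z ((mul_eq_zero.1 hz).resolve_left hB0)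
  simp only [hcoeff] at he ho
  have he' : IsPF2 fun k => (ξ (2 * k + 2) : ℝ) :=
    ⟨fun k => he.1 (k + 1), fun i j h => he.2 (i + 1) (j + 1) (by omega)⟩
  have hlc : ∀ a : ℕ → ℕ, IsPF2 (fun k => (a k : ℝ)) → ∀ k, a k * a (k + 2) ≤ a (k + 1) ^ 2 := by
    intro a ha k
    have h : (a k : ℝ) * a (k + 2) ≤ a (k + 1) * a (k + 1) := ha.2 k k le_rfl
    rw [sq]
    exact_mod_cast h
  have hbig : ∀ m, P.natDegree < m → (ξ m : ℝ) = 0 := fun m hm => by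
    rw [← hcoeff, coeff_eq_zero_of_natDegree_lt hm]
  refine ⟨hlc _ ho, hlc _ he', ?_, ?_⟩
  · obtain ⟨t, h1, h2⟩ := ho.unimodal (N := P.natDegree) fun k hk => hbig _ (by omega)
    exact ⟨t, fun k hk => by exact_mod_cast h1 k hk, fun k hk => by exact_mod_cast h2 k hk⟩
  · obtain ⟨t, h1, h2⟩ := he'.unimodal (N := P.natDegree) fun k hk => hbig _ (by omega)
    exact ⟨t, fun k hk => by exact_mod_cast h1 k hk, fun k hk => by exact_mod_cast h2 k hk⟩
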